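/- arXiv:1909.03609 — 2 statements merged into one kernel-verified Lean document; each statement's English description precedes it below -/
import Mathlib

section
/- Let a be either (1,0,0) or (0,1,0). There exist positive constants A, ε₀, c, all independent of ε and p, with the following property. Let 0 < ε ≤ ε₀, let p = (0,0,p₃) with |p₃| ≤ 1/2, and let r be a function such that: r is harmonic on ℝ³ ∖ (closure of D₁ ∪ D₂ ∪ {p}); r − a·∇N_p extends harmonically to a neighborhood of p; r extends continuously to ∂D₁ ∪ ∂D₂ with boundary value 0 there; and r(x) = O(|x|⁻²) as |x| → ∞. Then for all x ∈ ℝ³ ∖ (closure of D₁ ∪ D₂) with x ≠ p, |∇r(x)| ≤ c |x−p|⁻³ exp( −A|x−p| / ((√ε+|p₃|)|x−p| + ε + |p₃|²) ). -/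
open MeasureTheory Metric Real Filter
open scoped RealInnerProductSpace

noncomputable section

/-- Three-dimensional Euclidean space. -/
abbrev E3 : Type := EuclideanSpace ℝ (Fin 3)

/-- Standard basis vectors. -/
def e0 : E3 := EuclideanSpace.single 0 1
def e1 : E3 := EuclideanSpace.single 1 1
def e2 : E3 := EuclideanSpace.single 2 1

/-- Centers of the two unit balls at distance `ε`. -/
def ctr1 (ε : ℝ) : E3 := (-(1 + ε / 2)) • e0
def ctr2 (ε : ℝ) : E3 := (1 + ε / 2) • e0

/-- The two spherical inclusions. -/
def D1 (ε : ℝ) : Set E3 := Metric.ball (ctr1 ε) 1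
def D2 (ε : ℝ) : Set E3 := Metric.ball (ctr2 ε) 1

/-- The dipole field `a·∇N_p`, where `N_p(x) = -1/(4π|x-p|)` so that
`∇N_p(x) = (x-p)/(4π|x-p|³)`. -/
def dip (a p x : E3) : ℝ := ⟪a, x - p⟫ / (4 * π * ‖x - p‖ ^ 3)

/-- `f` is harmonic on the set `s`: it is twice continuously differentiable there and
its Laplacian vanishes at every point of `s`. -/
def IsHarmonicOn (f : E3 → ℝ) (s : Set E3) : Prop :=
  ContDiffOn ℝ 2 f s ∧
  ∀ x ∈ s, ∑ i : Fin 3,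
    fderiv ℝ (fun y => fderiv ℝ f y (EuclideanSpace.single i 1)) x
      (EuclideanSpace.single i 1) = 0

/-- The flux `∫_{∂B(c,1)} ∂_ν u dσ` across the unit sphere centered at `c`,
with `ν` the inward unit normal and `σ` the 2-dimensional Hausdorff (surface) measure. -/
def flux (u : E3 → ℝ) (c : E3) : ℝ :=
  ∫ x in Metric.sphere c 1, ⟪c - x, gradient u x⟫ ∂(μH[2])

/-- `u` is a solution of the emitter problem with dipole direction `a`, emitter location `p`,
inclusions `D1 ε`, `D2 ε`, and (unprescribed) constant boundary values `b₁`, `b₂`. -/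
structure IsEmitterSol (ε : ℝ) (p a : E3) (u : E3 → ℝ) (b₁ b₂ : ℝ) : Prop where
  /-- `u` is harmonic outside the closure of `D₁ ∪ D₂ ∪ {p}`. -/
  harm : IsHarmonicOn u (closure (D1 ε ∪ D2 ε) ∪ {p})ᶜ
  /-- `u - a·∇N_p` extends harmonically to a neighborhood of `p`. -/
  emitter : ∃ V : Set E3, IsOpen V ∧ p ∈ V ∧ ∃ h : E3 → ℝ, IsHarmonicOn h V ∧
      ∀ x ∈ V \ {p}, u x = dip a p x + h x
  /-- `u` extends continuously to `∂D₁` with constant value `b₁`. -/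
  bdry1 : ∀ x ∈ Metric.sphere (ctr1 ε) 1,
      Filter.Tendsto u (nhdsWithin x (closure (D1 ε ∪ D2 ε))ᶜ) (nhds b₁)
  /-- `u` extends continuously to `∂D₂` with constant value `b₂`. -/
  bdry2 : ∀ x ∈ Metric.sphere (ctr2 ε) 1,
      Filter.Tendsto u (nhdsWithin x (closure (D1 ε ∪ D2 ε))ᶜ) (nhds b₂)
  /-- zero flux across `∂D₁`. -/
  flux1 : flux u (ctr1 ε) = 0
  /-- zero flux across `∂D₂`. -/
  flux2 : flux u (ctr2 ε) = 0
  /-- `u(x) = O(|x|⁻²)` as `|x| → ∞`. -/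
  decay : ∃ C R : ℝ, ∀ x : E3, R ≤ ‖x‖ → |u x| ≤ C / ‖x‖ ^ 2

open scoped Topology

/-- The `i`-th coordinate direction. -/
def edir (i : Fin 3) : E3 := EuclideanSpace.single i 1

/-- The second derivatives of `f` at `x` along the coordinate lines exist and sum to `L`. -/
def HasLap (f : E3 → ℝ) (x : E3) (L : ℝ) : Prop :=
  ∃ (g : Fin 3 → ℝ → ℝ) (m : Fin 3 → ℝ),
    (∀ i, (∀ᶠ t in 𝓝 (0 : ℝ), HasDerivAt (fun s : ℝ => f (x + s • edir i)) (g i t) t) ∧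
      HasDerivAt (g i) (m i) 0) ∧ ∑ i, m i = L

lemma edir_apply (i j : Fin 3) : edir i j = if j = i then 1 else 0 := by
  simp [edir]

lemma norm_sq_E3 (x : E3) : ‖x‖ ^ 2 = x 0 ^ 2 + x 1 ^ 2 + x 2 ^ 2 := by
  simp [EuclideanSpace.norm_sq_eq, Fin.sum_univ_three]

lemma abs_coord_le (x : E3) (i : Fin 3) : |x i| ≤ ‖x‖ := by
  simpa using PiLp.norm_apply_le x i

lemma tendsto_line (x : E3) (i : Fin 3) :
    Tendsto (fun s : ℝ => x + s • edir i) (𝓝 0) (𝓝 x) := by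
  have : Continuous fun s : ℝ => x + s • edir i := by fun_prop
  simpa using this.tendsto 0

lemma HasLap.add {f g : E3 → ℝ} {x : E3} {L K : ℝ} (hf : HasLap f x L) (hg : HasLap g x K) :
    HasLap (fun y => f y + g y) x (L + K) := by
  obtain ⟨f', m, hf, rfl⟩ := hf
  obtain ⟨g', n, hg, rfl⟩ := hg
  refine ⟨fun i t => f' i t + g' i t, fun i => m i + n i, fun i => ⟨?_, ?_⟩, ?_⟩
  · filter_upwards [(hf i).1, (hg i).1] with t h1 h2 using h1.add h2
  · exact (hf i).2.add (hg i).2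
  · exact Finset.sum_add_distrib

lemma HasLap.const_mul {f : E3 → ℝ} {x : E3} {L : ℝ} (c : ℝ) (hf : HasLap f x L) :
    HasLap (fun y => c * f y) x (c * L) := by
  obtain ⟨f', m, hf, rfl⟩ := hf
  refine ⟨fun i t => c * f' i t, fun i => c * m i, fun i => ⟨?_, ?_⟩, ?_⟩
  · filter_upwards [(hf i).1] with t h1 using h1.const_mul c
  · exact (hf i).2.const_mul c
  · exact (Finset.mul_sum _ _ _).symm

lemma hasLap_const (c : ℝ) (x : E3) : HasLap (fun _ => c) x 0 :=
  ⟨fun _ _ => 0, fun _ => 0, fun _ => ⟨.of_forall fun t => hasDerivAt_const t c,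
    hasDerivAt_const _ _⟩, by simp⟩

lemma HasLap.congr {f g : E3 → ℝ} {x : E3} {L : ℝ} (hf : HasLap f x L) (h : g =ᶠ[𝓝 x] f) :
    HasLap g x L := by
  obtain ⟨f', m, hf, rfl⟩ := hf
  refine ⟨f', m, fun i => ⟨?_, (hf i).2⟩, rfl⟩
  filter_upwards [(hf i).1, ((tendsto_line x i).eventually h).eventually_nhds] with t h1 h2
  exact h1.congr_of_eventuallyEq h2

lemma not_isLocalMax_of_deriv2_pos {φ g : ℝ → ℝ} {m : ℝ}
    (h1 : ∀ᶠ t in 𝓝 (0 : ℝ), HasDerivAt φ (g t) t) (h2 : HasDerivAt g m 0) (hm : 0 < m)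
    (hmax : IsLocalMax φ 0) : False := by
  have hd : deriv φ =ᶠ[𝓝 0] g := h1.mono fun t ht => ht.deriv
  have hd2 : deriv (deriv φ) 0 = m := by rw [hd.deriv_eq, h2.deriv]
  have hmin : IsLocalMin φ 0 := by
    apply isLocalMin_of_deriv_deriv_pos (by rwa [hd2])
    · exact hmax.deriv_eq_zero
    · exact h1.self_of_nhds.continuousAt
  have hc : φ =ᶠ[𝓝 0] fun _ => φ 0 := by
    filter_upwards [hmax, hmin] with t ha hb using le_antisymm ha hb
  have : deriv (deriv φ) 0 = 0 := by
    have h3 : deriv φ =ᶠ[𝓝 0] fun _ => 0 := by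
      filter_upwards [hc.eventually_nhds] with t ht
      have : deriv φ t = deriv (fun _ => φ 0) t := Filter.EventuallyEq.deriv_eq ht
      simpa using this
    rw [h3.deriv_eq]; simp
  linarith

lemma HasLap.not_isLocalMax {f : E3 → ℝ} {x : E3} {L : ℝ} (hf : HasLap f x L) (hL : 0 < L)
    (hmax : IsLocalMax f x) : False := by
  obtain ⟨g, m, h, rfl⟩ := hf
  obtain ⟨i, -, hi⟩ := Finset.exists_lt_of_sum_lt (s := Finset.univ) (f := fun _ : Fin 3 => (0 : ℝ))
    (g := m) (by simpa using hL)
  refine not_isLocalMax_of_deriv2_pos (h i).1 (h i).2 hi ?_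
  have := (tendsto_line x i).eventually hmax
  simpa [IsLocalMax, IsMaxFilter] using this

lemma hasLap_norm_sq (c x : E3) : HasLap (fun y => ‖y - c‖ ^ 2) x 6 := by
  refine ⟨fun i t => 2 * ((x - c) i) + 2 * t, fun i => 2, fun i => ⟨.of_forall fun t => ?_, ?_⟩,
    by norm_num⟩
  · have : (fun s : ℝ => ‖x + s • edir i - c‖ ^ 2) =
        fun s => ‖x - c‖ ^ 2 + 2 * (x - c) i * s + s ^ 2 := by
      funext s
      rw [norm_sq_E3, norm_sq_E3]
      fin_cases i <;> simp [edir_apply] <;> ring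
    rw [this]
    refine (((hasDerivAt_id t).const_mul (2 * (x - c) i)).const_add (‖x - c‖ ^ 2)
      |>.add ((hasDerivAt_id t).pow 2)).congr_deriv ?_
    simp
  · simpa using ((hasDerivAt_id (0 : ℝ)).const_mul 2).const_add (2 * (x - c) i)

/-- Maximum principle for functions with nonnegative Laplacian on an open set, possibly unbounded:
if the boundary values and the values at infinity are asymptotically nonpositive, then so is the
function. -/
lemma max_principle {U : Set E3} (hU : IsOpen U) {f : E3 → ℝ} (hc : ContinuousOn f U)
    (hl : ∀ x ∈ U, ∃ L, 0 ≤ L ∧ HasLap f x L)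
    (hb : ∀ y ∈ frontier U, ∀ η > 0, ∀ᶠ x in 𝓝[U] y, f x < η)
    (hi : ∀ η > 0, ∃ ρ : ℝ, ∀ x ∈ U, ρ ≤ ‖x‖ → f x < η) :
    ∀ x ∈ U, f x ≤ 0 := by
  intro x₀ hx₀
  by_contra! hpos
  set η := f x₀ / 2 with hη
  have hη0 : 0 < η := by positivity
  set K : Set E3 := {x ∈ U | η ≤ f x} with hK
  obtain ⟨ρ, hρ⟩ := hi η hη0
  have hKb : ∀ x ∈ K, ‖x‖ ≤ ρ := by
    intro x hx
    by_contra! h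
    exact absurd (hρ x hx.1 h.le) (not_lt.2 hx.2)
  have hKc : IsCompact K := by
    apply Metric.isCompact_of_isClosed_isBounded
    · apply isClosed_of_closure_subset
      intro y hy
      have hyU : y ∈ U := by
        by_contra hn
        have hyf : y ∈ frontier U :=
          ⟨closure_mono (fun z hz => hz.1) hy, by rwa [hU.interior_eq]⟩
        have h1 := hb y hyf η hη0
        rw [eventually_nhdsWithin_iff] at h1
        have h2 := mem_closure_iff_frequently.1 hy
        obtain ⟨z, hz1, hz2⟩ := (h2.and_eventually h1).exists
        exact absurd (hz2 hz1.1) (not_lt.2 hz1.2)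
      refine ⟨hyU, ?_⟩
      have hcy : ContinuousAt f y := hc.continuousAt (hU.mem_nhds hyU)
      by_contra! hlt
      have h2 := mem_closure_iff_frequently.1 hy
      obtain ⟨z, hz1, hz2⟩ := (h2.and_eventually (hcy.eventually (gt_mem_nhds hlt))).exists
      exact absurd hz2 (not_lt.2 hz1.2)
    · exact (Metric.isBounded_closedBall (x := (0 : E3)) (r := ρ)).subset fun x hx => by
        simpa using hKb x hx
  have hx₀K : x₀ ∈ K := ⟨hx₀, by simp only [hη]; linarith⟩
  have hρ0 : 0 ≤ ρ := (norm_nonneg _).trans (hKb x₀ hx₀K)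
  set ζ := η / (2 * (ρ ^ 2 + 1)) with hζ
  have hζ0 : 0 < ζ := by positivity
  have hζη : ζ * ρ ^ 2 < η := by
    rw [hζ, div_mul_eq_mul_div, div_lt_iff₀ (by positivity)]
    nlinarith [sq_nonneg ρ]
  obtain ⟨y, hyK, hy⟩ := hKc.exists_isMaxOn (f := fun x => f x + ζ * ‖x - 0‖ ^ 2) ⟨x₀, hx₀K⟩
    ((hc.mono fun x hx => hx.1).add (by fun_prop))
  have hyη : η < f y := by
    have h1 : f x₀ + ζ * ‖x₀ - 0‖ ^ 2 ≤ f y + ζ * ‖y - 0‖ ^ 2 := hy hx₀K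
    have h2 : ζ * ‖y - 0‖ ^ 2 ≤ ζ * ρ ^ 2 := by
      rw [sub_zero]
      have := hKb y hyK
      gcongr
    have h3 : 0 ≤ ζ * ‖x₀ - 0‖ ^ 2 := by positivity
    have h4 : f x₀ = 2 * η := by rw [hη]; ring
    linarith
  have hloc : ∀ᶠ z in 𝓝 y, z ∈ K := by
    filter_upwards [hU.mem_nhds hyK.1,
      (hc.continuousAt (hU.mem_nhds hyK.1)).eventually (lt_mem_nhds hyη)] with z h1 h2
    exact ⟨h1, le_of_lt h2⟩
  obtain ⟨L, hL0, hL⟩ := hl y hyK.1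
  refine (hL.add ((hasLap_norm_sq 0 y).const_mul ζ)).not_isLocalMax (by positivity) ?_
  filter_upwards [hloc] with z hz using hy hz

lemma max_principle_bounded {U : Set E3} (hU : IsOpen U) (hbd : Bornology.IsBounded U)
    {f : E3 → ℝ} (hc : ∀ x ∈ closure U, ContinuousAt f x)
    (hl : ∀ x ∈ U, ∃ L, 0 ≤ L ∧ HasLap f x L)
    (hb : ∀ y ∈ frontier U, f y ≤ 0) :
    ∀ x ∈ U, f x ≤ 0 := by
  refine max_principle hU (fun x hx => (hc x (subset_closure hx)).continuousWithinAt) hl ?_ ?_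
  · intro y hy η hη
    exact nhdsWithin_le_nhds
      ((hc y (frontier_subset_closure hy)).eventually (gt_mem_nhds ((hb y hy).trans_lt hη)))
  · intro η hη
    obtain ⟨ρ, hρ⟩ := hbd.exists_norm_le
    refine ⟨ρ + 1, fun x hx h => ?_⟩
    have := hρ x hx
    linarith

lemma IsHarmonicOn.hasLap {f : E3 → ℝ} {s : Set E3} (hf : IsHarmonicOn f s) (hs : IsOpen s)
    {x : E3} (hx : x ∈ s) : HasLap f x 0 := by
  have hd1 : ∀ y ∈ s, DifferentiableAt ℝ f y := fun y hy =>
    (hf.1.contDiffAt (hs.mem_nhds hy)).differentiableAt (by norm_num)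
  have hd2 : DifferentiableAt ℝ (fderiv ℝ f) x :=
    ((hf.1.contDiffAt (hs.mem_nhds hx)).fderiv_right (m := 1) (by norm_num)).differentiableAt
      (by norm_num)
  have hline : ∀ (i : Fin 3) (t : ℝ), HasDerivAt (fun s : ℝ => x + s • edir i) (edir i) t := by
    intro i t
    simpa using ((hasDerivAt_id t).smul_const (edir i)).const_add x
  refine ⟨fun i t => fderiv ℝ f (x + t • edir i) (edir i),
    fun i => fderiv ℝ (fun y => fderiv ℝ f y (edir i)) x (edir i), fun i => ⟨?_, ?_⟩, hf.2 x hx⟩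
  · filter_upwards [(tendsto_line x i).eventually (hs.mem_nhds hx)] with t ht
    exact (hd1 _ ht).hasFDerivAt.comp_hasDerivAt t (hline i t)
  · have h1 : DifferentiableAt ℝ (fun y => fderiv ℝ f y (edir i)) (x + (0 : ℝ) • edir i) := by
      simpa using hd2.clm_apply (differentiableAt_const _)
    simpa [Function.comp_def] using h1.hasFDerivAt.comp_hasDerivAt (0 : ℝ) (hline i 0)

/-- Reflection in the plane where the `k`-th coordinate equals `c`. -/
def mirror (k : Fin 3) (c : ℝ) (y : E3) : E3 := y - (2 * (y k - c)) • edir k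

lemma mirror_apply_self (k : Fin 3) (c : ℝ) (y : E3) : mirror k c y k = 2 * c - y k := by
  simp [mirror, edir_apply]; ring

lemma mirror_apply_of_ne {k j : Fin 3} (h : j ≠ k) (c : ℝ) (y : E3) : mirror k c y j = y j := by
  simp [mirror, edir_apply, h]

lemma mirror_mirror (k : Fin 3) (c : ℝ) (y : E3) : mirror k c (mirror k c y) = y := by
  ext j
  by_cases h : j = k
  · subst h; simp only [mirror_apply_self]; ring
  · simp only [mirror_apply_of_ne h]

lemma continuous_mirror (k : Fin 3) (c : ℝ) : Continuous (mirror k c) := by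
  unfold mirror; fun_prop

lemma norm_mirror_sub_mirror (k : Fin 3) (c : ℝ) (y z : E3) :
    ‖mirror k c y - mirror k c z‖ = ‖y - z‖ := by
  rw [← sq_eq_sq₀ (norm_nonneg _) (norm_nonneg _), norm_sq_E3, norm_sq_E3]
  fin_cases k <;> simp [mirror, edir_apply] <;> ring

lemma mirror_eq_self {k : Fin 3} {c : ℝ} {y : E3} (h : y k = c) : mirror k c y = y := by
  simp [mirror, h]

lemma HasLap.comp_mirror {f : E3 → ℝ} {k : Fin 3} {c : ℝ} {y : E3} {L : ℝ}
    (hf : HasLap f (mirror k c y) L) : HasLap (fun z => f (mirror k c z)) y L := by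
  obtain ⟨g, m, h, rfl⟩ := hf
  have key : ∀ i : Fin 3, ∃ s : ℝ, s * s = 1 ∧
      ∀ t : ℝ, mirror k c (y + t • edir i) = mirror k c y + (s * t) • edir i := by
    intro i
    by_cases hik : i = k
    · subst hik
      refine ⟨-1, by norm_num, fun t => ?_⟩
      ext j
      by_cases hj : j = i
      · subst hj; simp [mirror, edir_apply]; ring
      · simp [mirror, edir_apply, hj]
    · refine ⟨1, by norm_num, fun t => ?_⟩
      ext j
      by_cases hj : j = k
      · subst hj; simp [mirror, edir_apply, Ne.symm hik]
      · simp [mirror, edir_apply, hj, Ne.symm hik]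
  choose s hs1 hs2 using key
  refine ⟨fun i t => g i (s i * t) * s i, m, fun i => ⟨?_, ?_⟩, rfl⟩
  · have ht : Tendsto (fun t : ℝ => s i * t) (𝓝 0) (𝓝 0) := by
      have : Continuous fun t : ℝ => s i * t := by fun_prop
      simpa using this.tendsto 0
    filter_upwards [ht.eventually (h i).1] with t h1
    simp only [hs2]
    have h2 : HasDerivAt (fun t : ℝ => s i * t) (s i) t := by
      simpa using (hasDerivAt_id t).const_mul (s i)
    exact h1.comp t h2
  · have h2 : HasDerivAt (fun t : ℝ => s i * t) (s i) 0 := by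
      simpa using (hasDerivAt_id (0 : ℝ)).const_mul (s i)
    have h1 : HasDerivAt (g i) (m i) (s i * 0) := by simpa using (h i).2
    refine ((h1.comp 0 h2).mul_const (s i)).congr_deriv ?_
    rw [mul_assoc, hs1, mul_one]

lemma hasLap_prod {φ φ' φ'' ψ ψ' ψ'' : ℝ → ℝ} (h1 : ∀ t, HasDerivAt φ (φ' t) t)
    (h2 : ∀ t, HasDerivAt φ' (φ'' t) t) (h3 : ∀ t, HasDerivAt ψ (ψ' t) t)
    (h4 : ∀ t, HasDerivAt ψ' (ψ'' t) t) {j k : Fin 3} (hjk : j ≠ k) (x : E3) :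
    HasLap (fun y => φ (y j) * ψ (y k)) x (φ'' (x j) * ψ (x k) + φ (x j) * ψ'' (x k)) := by
  refine ⟨fun i t => if i = j then φ' (x j + t) * ψ (x k) else
      if i = k then φ (x j) * ψ' (x k + t) else 0,
    fun i => (if i = j then φ'' (x j) * ψ (x k) else 0) +
      (if i = k then φ (x j) * ψ'' (x k) else 0), fun i => ?_, ?_⟩
  · have hsh : ∀ (a t : ℝ), HasDerivAt (fun s : ℝ => a + s) 1 t := fun a t =>
      (hasDerivAt_id t).const_add a
    by_cases hij : i = j
    · subst hij
      refine ⟨.of_forall fun t => ?_, ?_⟩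
      · simpa [edir_apply, hjk.symm] using
          ((h1 (x i + t)).comp t (hsh (x i) t)).mul_const (ψ (x k))
      · have := ((h2 (x i + 0)).comp 0 (hsh (x i) 0)).mul_const (ψ (x k))
        simpa [hjk] using this
    · by_cases hik : i = k
      · subst hik
        refine ⟨.of_forall fun t => ?_, ?_⟩
        · simpa [edir_apply, hjk, hij] using
            ((h3 (x i + t)).comp t (hsh (x i) t)).const_mul (φ (x j))
        · have := ((h4 (x i + 0)).comp 0 (hsh (x i) 0)).const_mul (φ (x j))
          simpa [hij] using this
      · refine ⟨.of_forall fun t => ?_, ?_⟩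
        · simpa [edir_apply, Ne.symm hij, Ne.symm hik, hij, hik] using
            hasDerivAt_const t (φ (x j) * ψ (x k))
        · simpa [hij, hik] using hasDerivAt_const (0 : ℝ) (0 : ℝ)
  · simp [Finset.sum_add_distrib]

lemma hasDerivAt_norm_line (q : E3) (i : Fin 3) (t : ℝ) (h : q + t • edir i ≠ 0) :
    HasDerivAt (fun s : ℝ => ‖q + s • edir i‖) ((q i + t) / ‖q + t • edir i‖) t := by
  have he : ∀ s : ℝ, ‖q + s • edir i‖ ^ 2 = ‖q‖ ^ 2 + 2 * q i * s + s ^ 2 := by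
    intro s
    rw [norm_sq_E3, norm_sq_E3]
    fin_cases i <;> simp [edir_apply] <;> ring
  have he2 : ∀ s : ℝ, ‖q + s • edir i‖ = √(‖q‖ ^ 2 + 2 * q i * s + s ^ 2) := fun s => by
    rw [← he, Real.sqrt_sq (norm_nonneg _)]
  have hp : HasDerivAt (fun s : ℝ => ‖q‖ ^ 2 + 2 * q i * s + s ^ 2) (2 * (q i + t)) t := by
    refine (((hasDerivAt_id t).const_mul (2 * q i)).const_add (‖q‖ ^ 2)
      |>.add ((hasDerivAt_id t).pow 2)).congr_deriv ?_
    simp; ring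
  have hne : ‖q‖ ^ 2 + 2 * q i * t + t ^ 2 ≠ 0 := by
    rw [← he]; exact pow_ne_zero _ (norm_ne_zero_iff.2 h)
  have := hp.sqrt hne
  simp only [he2]
  refine this.congr_deriv ?_
  rw [mul_div_mul_left _ _ two_ne_zero]

lemma hasDerivAt_inv_norm_pow_line (q : E3) (i : Fin 3) (n : ℕ) (t : ℝ) (h : q + t • edir i ≠ 0) :
    HasDerivAt (fun s : ℝ => (‖q + s • edir i‖ ^ (n + 1))⁻¹)
      (-(n + 1) * (q i + t) * (‖q + t • edir i‖ ^ (n + 3))⁻¹) t := by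
  have hn : ‖q + t • edir i‖ ≠ 0 := norm_ne_zero_iff.2 h
  refine (((hasDerivAt_norm_line q i t h).pow (n + 1)).inv (pow_ne_zero _ hn)).congr_deriv ?_
  simp only [Nat.add_sub_cancel, Nat.cast_add, Nat.cast_one, Pi.pow_apply]
  field_simp
  ring

lemma eventually_line_ne_zero {q : E3} (h : q ≠ 0) (i : Fin 3) :
    ∀ᶠ t in 𝓝 (0 : ℝ), q + t • edir i ≠ 0 :=
  (tendsto_line q i).eventually (isOpen_ne.mem_nhds h)

lemma hasLap_inv_norm {c x : E3} (h : x ≠ c) : HasLap (fun y => ‖y - c‖⁻¹) x 0 := by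
  have hq : x - c ≠ 0 := sub_ne_zero.2 h
  have hn : ‖x - c‖ ≠ 0 := norm_ne_zero_iff.2 hq
  set q := x - c with hqd
  refine ⟨fun i t => -(q i + t) * (‖q + t • edir i‖ ^ 3)⁻¹,
    fun i => -(‖q‖ ^ 3)⁻¹ + 3 * q i ^ 2 * (‖q‖ ^ 5)⁻¹, fun i => ⟨?_, ?_⟩, ?_⟩
  · filter_upwards [eventually_line_ne_zero hq i] with t ht
    have h1 := hasDerivAt_inv_norm_pow_line q i 0 t ht
    have h2 : ∀ s : ℝ, x + s • edir i - c = q + s • edir i := fun s => by rw [hqd]; abel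
    simp only [h2]
    simpa using h1
  · have h1 := hasDerivAt_inv_norm_pow_line q i 2 0 (by simpa using hq)
    have h2 : HasDerivAt (fun t : ℝ => -(q i + t)) (-1) 0 :=
      ((hasDerivAt_id (0 : ℝ)).const_add (q i)).neg
    refine (h2.mul h1).congr_deriv ?_
    norm_num
    ring
  · have h3 := norm_sq_E3 q
    simp only [Fin.sum_univ_three]
    have : -(‖q‖ ^ 3)⁻¹ + 3 * q 0 ^ 2 * (‖q‖ ^ 5)⁻¹ + (-(‖q‖ ^ 3)⁻¹ + 3 * q 1 ^ 2 * (‖q‖ ^ 5)⁻¹)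
        + (-(‖q‖ ^ 3)⁻¹ + 3 * q 2 ^ 2 * (‖q‖ ^ 5)⁻¹)
        = -3 * (‖q‖ ^ 3)⁻¹ + 3 * (q 0 ^ 2 + q 1 ^ 2 + q 2 ^ 2) * (‖q‖ ^ 5)⁻¹ := by ring
    rw [this, ← h3]
    field_simp
    ring

lemma hasLap_coord_div_norm_cube {c x : E3} (k : Fin 3) (h : x ≠ c) :
    HasLap (fun y => (y - c) k * (‖y - c‖ ^ 3)⁻¹) x 0 := by
  have hq : x - c ≠ 0 := sub_ne_zero.2 h
  have hn : ‖x - c‖ ≠ 0 := norm_ne_zero_iff.2 hq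
  set q := x - c with hqd
  have hk : ∀ (i : Fin 3) (t : ℝ), HasDerivAt (fun s : ℝ => (q + s • edir i) k) (edir i k) t := by
    intro i t
    simpa using ((hasDerivAt_id t).mul_const (edir i k)).const_add (q k)
  refine ⟨fun i t => edir i k * (‖q + t • edir i‖ ^ 3)⁻¹ +
      (q + t • edir i) k * (-3 * (q i + t) * (‖q + t • edir i‖ ^ 5)⁻¹),
    fun i => edir i k * (-6 * q i * (‖q‖ ^ 5)⁻¹) +
      q k * (-3 * (‖q‖ ^ 5)⁻¹ + 15 * q i ^ 2 * (‖q‖ ^ 7)⁻¹), fun i => ⟨?_, ?_⟩, ?_⟩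
  · filter_upwards [eventually_line_ne_zero hq i] with t ht
    have h1 := hasDerivAt_inv_norm_pow_line q i 2 t ht
    have h2 : ∀ s : ℝ, x + s • edir i - c = q + s • edir i := fun s => by rw [hqd]; abel
    simp only [h2]
    refine ((hk i t).mul h1).congr_deriv ?_
    norm_num
  · have h1 := hasDerivAt_inv_norm_pow_line q i 2 0 (by simpa using hq)
    have h5 := hasDerivAt_inv_norm_pow_line q i 4 0 (by simpa using hq)
    have h2 : HasDerivAt (fun t : ℝ => -3 * (q i + t)) (-3) 0 := by
      simpa using ((hasDerivAt_id (0 : ℝ)).const_add (q i)).const_mul (-3)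
    refine ((h1.const_mul (edir i k)).add ((hk i 0).mul (h2.mul h5))).congr_deriv ?_
    norm_num
    ring
  · have h3 := norm_sq_E3 q
    simp only [Fin.sum_univ_three]
    have : ∀ A B : ℝ, (edir 0 k * (-6 * q 0 * A) + q k * (-3 * A + 15 * q 0 ^ 2 * B)) +
        (edir 1 k * (-6 * q 1 * A) + q k * (-3 * A + 15 * q 1 ^ 2 * B)) +
        (edir 2 k * (-6 * q 2 * A) + q k * (-3 * A + 15 * q 2 ^ 2 * B)) =
        15 * q k * ((q 0 ^ 2 + q 1 ^ 2 + q 2 ^ 2) * B - A) := by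
      intro A B
      fin_cases k <;> simp [edir_apply] <;> ring
    rw [this, ← h3]
    field_simp
    ring

lemma HasLap.neg {f : E3 → ℝ} {x : E3} (hf : HasLap f x 0) : HasLap (fun y => -f y) x 0 := by
  simpa using hf.const_mul (-1)

lemma HasLap.sub {f g : E3 → ℝ} {x : E3} {L K : ℝ} (hf : HasLap f x L) (hg : HasLap g x K) :
    HasLap (fun y => f y - g y) x (L - K) := by
  simpa [sub_eq_add_neg] using hf.add (hg.const_mul (-1))

lemma sub_mirror_le {u : E3 → ℝ} {z : E3} {s M : ℝ} (hs : 0 < s)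
    (hc : ∀ y, ‖y - z‖ ≤ s → ContinuousAt u y) (hl : ∀ y, ‖y - z‖ ≤ s → HasLap u y 0)
    (hM : ∀ y, ‖y - z‖ ≤ s → |u y| ≤ M) (k : Fin 3) {y : E3} (hy : ‖y - z‖ < s)
    (hyk : z k < y k) (hyz : ‖y - z‖ = y k - z k) :
    u y - u (mirror k (z k) y) ≤ 6 * M / s * (y k - z k) := by
  have hz : mirror k (z k) z = z := mirror_eq_self rfl
  have hmir : ∀ y, ‖mirror k (z k) y - z‖ = ‖y - z‖ := fun y => by
    have := norm_mirror_sub_mirror k (z k) y z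
    rwa [hz] at this
  have hM0 : 0 ≤ M := (abs_nonneg _).trans (hM z (by simpa using hs.le))
  set w : E3 → ℝ := fun y => 2 * M / s ^ 2 * ‖y - z‖ ^ 2 +
    (6 * M / s * (y k - z k) - 6 * M / s ^ 2 * (y k - z k) ^ 2) with hw
  set U : Set E3 := {y | z k < y k ∧ ‖y - z‖ < s} with hU
  have hUo : IsOpen U := by
    have h1 : IsOpen {y : E3 | z k < y k} := isOpen_lt (by fun_prop) (by fun_prop)
    have h2 : IsOpen {y : E3 | ‖y - z‖ < s} := isOpen_lt (by fun_prop) (by fun_prop)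
    exact h1.and h2
  have hcl : closure U ⊆ {y | z k ≤ y k ∧ ‖y - z‖ ≤ s} := by
    apply closure_minimal
    · exact fun y hy => ⟨hy.1.le, hy.2.le⟩
    · have h1 : IsClosed {y : E3 | z k ≤ y k} := isClosed_le (by fun_prop) (by fun_prop)
      have h2 : IsClosed {y : E3 | ‖y - z‖ ≤ s} := isClosed_le (by fun_prop) (by fun_prop)
      exact h1.inter h2
  have hwl : ∀ y, HasLap w y 0 := by
    intro y
    obtain ⟨j, hj⟩ : ∃ j : Fin 3, k ≠ j := (exists_ne k).imp fun _ h => h.symm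
    have h1 := hasLap_prod (φ := fun t => 6 * M / s * (t - z k) - 6 * M / s ^ 2 * (t - z k) ^ 2)
      (φ' := fun t => 6 * M / s - 12 * M / s ^ 2 * (t - z k))
      (φ'' := fun t => - (12 * M / s ^ 2)) (ψ := fun _ => 1) (ψ' := fun _ => 0)
      (ψ'' := fun _ => 0) ?_ ?_ (fun t => hasDerivAt_const t _) (fun t => hasDerivAt_const t _) hj y
    · have h2 := ((hasLap_norm_sq z y).const_mul (2 * M / s ^ 2)).add h1
      simp only [mul_one, mul_zero, add_zero] at h2
      convert h2 using 1
      ring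
    · intro t
      have h := (hasDerivAt_id t).sub_const (z k)
      refine ((h.const_mul (6 * M / s)).sub ((h.pow 2).const_mul (6 * M / s ^ 2))).congr_deriv ?_
      simp; ring
    · intro t
      have h := (hasDerivAt_id t).sub_const (z k)
      refine ((h.const_mul (12 * M / s ^ 2)).const_sub (6 * M / s)).congr_deriv ?_
      simp
  have hτ : ∀ y, |y k - z k| ≤ ‖y - z‖ := fun y => by simpa using abs_coord_le (y - z) k
  have key := max_principle_bounded (U := U) hUo
    ((Metric.isBounded_ball (x := z) (r := s)).subset fun y hy => by
      simpa [dist_eq_norm] using hy.2)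
    (f := fun y => u y - u (mirror k (z k) y) - w y) ?_ ?_ ?_ y ⟨hyk, hy⟩
  · have h1 : w y ≤ 6 * M / s * (y k - z k) := by
      have h2 : 0 ≤ 4 * M / s ^ 2 * (y k - z k) ^ 2 := by positivity
      have h3 : w y = 6 * M / s * (y k - z k) - 4 * M / s ^ 2 * (y k - z k) ^ 2 := by
        simp only [hw, hyz]; ring
      linarith
    linarith
  · intro y hy
    have h2 := (hcl hy).2
    refine ((hc y h2).sub ?_).sub ?_
    · exact ContinuousAt.comp (hc _ (by rwa [hmir])) (continuous_mirror _ _).continuousAt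
    · rw [hw]; fun_prop
  · intro y hy
    have h2 := hy.2.le
    refine ⟨0, le_rfl, ?_⟩
    simpa using ((hl y h2).sub (hl _ (by rwa [hmir])).comp_mirror).sub (hwl y)
  · intro y hy
    obtain ⟨h1, h2⟩ := hcl (frontier_subset_closure hy)
    have hnot : y ∉ U := by
      have := hy.2
      rwa [hUo.interior_eq] at this
    by_cases hk : y k = z k
    · have : 0 ≤ w y := by simp only [hw, hk]; simp; positivity
      simp only [mirror_eq_self hk]
      linarith
    · have hs' : ‖y - z‖ = s := by
        apply le_antisymm h2
        by_contra! h
        exact hnot ⟨lt_of_le_of_ne h1 (Ne.symm hk), h⟩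
      have ha := abs_le.1 (hM y h2)
      have hb := abs_le.1 (hM (mirror k (z k) y) (by rwa [hmir]))
      have hwy : 2 * M ≤ w y := by
        have h3 := (le_abs_self _).trans (hτ y)
        rw [hs'] at h3
        have : w y = 2 * M + 6 * M / s ^ 2 * ((y k - z k) * (s - (y k - z k))) := by
          simp only [hw, hs']; field_simp
        rw [this]
        have : 0 ≤ (y k - z k) * (s - (y k - z k)) := mul_nonneg (by linarith) (by linarith)
        have : 0 ≤ 6 * M / s ^ 2 * ((y k - z k) * (s - (y k - z k))) := by positivity
        linarith
      show u y - u (mirror k (z k) y) - w y ≤ 0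
      linarith

lemma norm_gradient_le {u : E3 → ℝ} {z : E3} {s M : ℝ} (hs : 0 < s)
    (hc : ∀ y, ‖y - z‖ ≤ s → ContinuousAt u y) (hl : ∀ y, ‖y - z‖ ≤ s → HasLap u y 0)
    (hM : ∀ y, ‖y - z‖ ≤ s → |u y| ≤ M) :
    ‖gradient u z‖ ≤ 9 * M / s := by
  have hM0 : 0 ≤ M := (abs_nonneg _).trans (hM z (by simpa using hs.le))
  by_cases hd : DifferentiableAt ℝ u z
  swap
  · rw [gradient_eq_zero_of_not_differentiableAt hd, norm_zero]; positivity
  have hone : ∀ (v : E3 → ℝ), DifferentiableAt ℝ v z → (∀ y, ‖y - z‖ ≤ s → ContinuousAt v y) →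
      (∀ y, ‖y - z‖ ≤ s → HasLap v y 0) → (∀ y, ‖y - z‖ ≤ s → |v y| ≤ M) → ∀ k : Fin 3,
      fderiv ℝ v z (edir k) ≤ 3 * M / s := by
    intro v hd hc hl hM k
    have hline : ∀ σ : ℝ, HasDerivAt (fun t : ℝ => z + (σ * t) • edir k) (σ • edir k) 0 := by
      intro σ
      simpa using (((hasDerivAt_id (0 : ℝ)).const_mul σ).smul_const (edir k)).const_add z
    have hv : ∀ σ : ℝ, HasDerivAt (fun t : ℝ => v (z + (σ * t) • edir k))
        (σ * fderiv ℝ v z (edir k)) 0 := by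
      intro σ
      have h1 : HasFDerivAt v (fderiv ℝ v z) (z + (σ * (0 : ℝ)) • edir k) := by
        simpa using hd.hasFDerivAt
      simpa [Function.comp_def] using h1.comp_hasDerivAt (0 : ℝ) (hline σ)
    have h2 := ((hv 1).sub (hv (-1))).tendsto_slope_zero_right
    have h3 : 1 * fderiv ℝ v z (edir k) - -1 * fderiv ℝ v z (edir k) ≤ 6 * M / s := by
      refine le_of_tendsto h2 ?_
      have hev : ∀ᶠ t in 𝓝[>] (0 : ℝ), t < s := nhdsWithin_le_nhds (gt_mem_nhds hs)
      filter_upwards [hev, self_mem_nhdsWithin] with t ht ht0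
      have ht0' : 0 < t := ht0
      have := sub_mirror_le hs hc hl hM k (y := z + t • edir k)
        (by simpa [norm_smul, edir, abs_of_pos ht0'] using ht) (by simpa [edir_apply] using ht0')
        (by simp [norm_smul, edir, abs_of_pos ht0'])
      have hm : mirror k (z k) (z + t • edir k) = z + (-t) • edir k := by
        simp only [mirror, PiLp.add_apply, PiLp.smul_apply, edir_apply, smul_eq_mul]
        simp only [if_true]
        module
      rw [hm] at this
      simp only [edir_apply, PiLp.add_apply, PiLp.smul_apply, smul_eq_mul, if_true] at this
      simp only [Pi.sub_apply, zero_add, one_mul, zero_smul, add_zero, sub_self, sub_zero,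
        smul_eq_mul, neg_mul, neg_zero]
      rw [inv_mul_le_iff₀ ht0']
      simp only [neg_smul] at this ⊢
      linarith
    have h4 : 6 * M / s = 2 * (3 * M / s) := by ring
    linarith
  have hcomp : ∀ k : Fin 3, |gradient u z k| ≤ 3 * M / s := by
    intro k
    have h1 : gradient u z k = fderiv ℝ u z (edir k) := by
      have h2 : ⟪gradient u z, edir k⟫ = fderiv ℝ u z (edir k) := by
        simp [gradient, InnerProductSpace.toDual_symm_apply]
      rw [← h2, edir, EuclideanSpace.inner_single_right]
      simp
    rw [h1, abs_le]
    constructor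
    · have := hone (fun y => -u y) hd.neg (fun y hy => (hc y hy).neg) (fun y hy => (hl y hy).neg)
        (fun y hy => by rw [abs_neg]; exact hM y hy) k
      rw [fderiv_fun_neg] at this
      simp at this
      linarith
    · exact hone u hd hc hl hM k
  have hB : 0 ≤ 3 * M / s := by positivity
  have h9 : 9 * M / s = 3 * (3 * M / s) := by ring
  rw [h9, ← abs_of_nonneg (norm_nonneg (gradient u z)), ← abs_of_nonneg (by positivity : 0 ≤ 3 * (3 * M / s)),
    ← sq_le_sq, norm_sq_E3]
  have := fun k => sq_le_sq' (abs_le.1 (hcomp k)).1 (abs_le.1 (hcomp k)).2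
  nlinarith [this 0, this 1, this 2]

/-- The exterior of the two closed unit balls. -/
def exterior (ε : ℝ) : Set E3 := {x | 1 < ‖x - ctr1 ε‖ ∧ 1 < ‖x - ctr2 ε‖}

lemma compl_closure_eq_exterior (ε : ℝ) : (closure (D1 ε ∪ D2 ε))ᶜ = exterior ε := by
  ext x
  simp [D1, D2, closure_union, closure_ball _ (one_ne_zero), exterior, dist_eq_norm]

lemma isOpen_exterior (ε : ℝ) : IsOpen (exterior ε) := by
  rw [← compl_closure_eq_exterior]
  exact isClosed_closure.isOpen_compl

lemma closure_exterior_subset (ε : ℝ) :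
    closure (exterior ε) ⊆ {x | 1 ≤ ‖x - ctr1 ε‖ ∧ 1 ≤ ‖x - ctr2 ε‖} := by
  refine closure_minimal (fun x hx => ⟨hx.1.le, hx.2.le⟩) ?_
  have h : ∀ c : E3, IsClosed {x : E3 | 1 ≤ ‖x - c‖} := fun c =>
    isClosed_le (by fun_prop) (by fun_prop)
  exact (h _).inter (h _)

lemma norm_sub_ctr1_sq (ε : ℝ) (x : E3) :
    ‖x - ctr1 ε‖ ^ 2 = (x 0 + (1 + ε / 2)) ^ 2 + x 1 ^ 2 + x 2 ^ 2 := by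
  rw [norm_sq_E3]; simp [ctr1, e0]; ring

lemma norm_sub_ctr2_sq (ε : ℝ) (x : E3) :
    ‖x - ctr2 ε‖ ^ 2 = (x 0 - (1 + ε / 2)) ^ 2 + x 1 ^ 2 + x 2 ^ 2 := by
  rw [norm_sq_E3]; simp [ctr2, e0]

lemma one_lt_norm_iff (y : E3) : 1 < ‖y‖ ↔ 1 < ‖y‖ ^ 2 := by
  rw [one_lt_sq_iff₀ (norm_nonneg _)]

lemma mem_exterior_iff {ε : ℝ} {x : E3} : x ∈ exterior ε ↔
    1 < (x 0 + (1 + ε / 2)) ^ 2 + x 1 ^ 2 + x 2 ^ 2 ∧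
    1 < (x 0 - (1 + ε / 2)) ^ 2 + x 1 ^ 2 + x 2 ^ 2 := by
  rw [← norm_sub_ctr1_sq, ← norm_sub_ctr2_sq, ← one_lt_norm_iff, ← one_lt_norm_iff]
  rfl

lemma mirror_mem_exterior {ε : ℝ} {k : Fin 3} {x : E3} (hx : x ∈ exterior ε) :
    mirror k 0 x ∈ exterior ε := by
  rw [mem_exterior_iff] at hx ⊢
  obtain ⟨h1, h2⟩ := hx
  fin_cases k <;> simp [mirror, edir_apply] <;> constructor <;> nlinarith

/-- The point at height `t` on the third coordinate axis. -/
def axisPt (t : ℝ) : E3 := t • e2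

lemma axisPt_apply (t : ℝ) (i : Fin 3) : axisPt t i = if i = 2 then t else 0 := by
  simp [axisPt, e2]

lemma mirror_axisPt {k : Fin 3} (hk : k ≠ 2) (t : ℝ) : mirror k 0 (axisPt t) = axisPt t :=
  mirror_eq_self (by simp [axisPt_apply, hk])

lemma norm_mirror_sub_axisPt {k : Fin 3} (hk : k ≠ 2) (t : ℝ) (x : E3) :
    ‖mirror k 0 x - axisPt t‖ = ‖x - axisPt t‖ := by
  have := norm_mirror_sub_mirror k 0 x (axisPt t)
  rwa [mirror_axisPt hk] at this

lemma mirror_ne_axisPt {k : Fin 3} (hk : k ≠ 2) {t : ℝ} {x : E3} (hx : x ≠ axisPt t) :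
    mirror k 0 x ≠ axisPt t := by
  rw [← sub_ne_zero, ← norm_ne_zero_iff, norm_mirror_sub_axisPt hk]
  exact norm_ne_zero_iff.2 (sub_ne_zero.2 hx)

lemma dip_eq (k : Fin 3) (t : ℝ) (x : E3) :
    dip (edir k) (axisPt t) x =
      (4 * π)⁻¹ * ((x - axisPt t) k * (‖x - axisPt t‖ ^ 3)⁻¹) := by
  rw [dip, edir, EuclideanSpace.inner_single_left]
  simp only [map_one, one_mul]
  rw [div_eq_mul_inv, mul_inv]; ring

lemma dip_eq' {k : Fin 3} (hk : k ≠ 2) (t : ℝ) (x : E3) :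
    dip (edir k) (axisPt t) x = (4 * π)⁻¹ * (x k * (‖x - axisPt t‖ ^ 3)⁻¹) := by
  rw [dip_eq k]; simp [axisPt_apply, hk]

lemma hasLap_dip (k : Fin 3) {t : ℝ} {x : E3} (hx : x ≠ axisPt t) :
    HasLap (dip (edir k) (axisPt t)) x 0 := by
  have := (hasLap_coord_div_norm_cube k hx).const_mul (4 * π)⁻¹
  rw [mul_zero] at this
  exact this.congr (.of_forall fun y => dip_eq k t y)

lemma continuousAt_dip {k : Fin 3} (hk : k ≠ 2) {t : ℝ} {x : E3} (hx : x ≠ axisPt t) :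
    ContinuousAt (dip (edir k) (axisPt t)) x := by
  have : dip (edir k) (axisPt t) = fun x => (4 * π)⁻¹ * (x k * (‖x - axisPt t‖ ^ 3)⁻¹) :=
    funext fun y => dip_eq' hk t y
  rw [this]
  have hn : ‖x - axisPt t‖ ^ 3 ≠ 0 := pow_ne_zero _ (norm_ne_zero_iff.2 (sub_ne_zero.2 hx))
  fun_prop (disch := assumption)

lemma dip_mirror {k : Fin 3} (hk : k ≠ 2) (t : ℝ) (x : E3) :
    dip (edir k) (axisPt t) (mirror k 0 x) = -dip (edir k) (axisPt t) x := by
  rw [dip_eq' hk, dip_eq' hk, norm_mirror_sub_axisPt hk, mirror_apply_self]; ring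

lemma dip_nonneg {k : Fin 3} (hk : k ≠ 2) (t : ℝ) {x : E3} (hx : 0 ≤ x k) :
    0 ≤ dip (edir k) (axisPt t) x := by
  rw [dip_eq' hk]; positivity

lemma dip_le (k : Fin 3) (t : ℝ) (x : E3) :
    dip (edir k) (axisPt t) x ≤ 1 / ‖x - axisPt t‖ ^ 2 := by
  by_cases hx : x - axisPt t = 0
  · simp [dip_eq k, hx]
  have hn : 0 < ‖x - axisPt t‖ := norm_pos_iff.2 hx
  rw [dip_eq k]
  have h1 := (le_abs_self _).trans (abs_coord_le (x - axisPt t) k)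
  have h2 : (4 * π)⁻¹ ≤ 1 := inv_le_one_of_one_le₀ (by linarith [pi_gt_three])
  calc _ ≤ (4 * π)⁻¹ * (‖x - axisPt t‖ * (‖x - axisPt t‖ ^ 3)⁻¹) := by gcongr
    _ ≤ 1 * (‖x - axisPt t‖ * (‖x - axisPt t‖ ^ 3)⁻¹) := by gcongr
    _ = _ := by field_simp

/-- The extension by zero of the solution with dipole direction `edir k` at `axisPt t`. -/
structure IsZeroExt (ε t : ℝ) (k : Fin 3) (R : E3 → ℝ) : Prop where
  lap : ∀ x ∈ exterior ε, x ≠ axisPt t → HasLap R x 0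
  cont : ∀ x, x ≠ axisPt t → ContinuousAt R x
  zero : ∀ x, x ∉ exterior ε → R x = 0
  sing : ∃ h : E3 → ℝ, ContinuousAt h (axisPt t) ∧
    ∀ᶠ x in 𝓝[≠] (axisPt t), R x = dip (edir k) (axisPt t) x + h x
  decay : ∀ η > 0, ∃ ρ : ℝ, ∀ x, ρ ≤ ‖x‖ → |R x| < η

lemma nonpos_of_bounded_near {ε : ℝ} {p : E3} {v : E3 → ℝ}
    (lap : ∀ x ∈ exterior ε, x ≠ p → HasLap v x 0) (cont : ∀ x, x ≠ p → ContinuousAt v x)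
    (zero : ∀ x, x ∉ exterior ε → v x = 0) (bdd : ∃ B, ∀ᶠ x in 𝓝[≠] p, v x ≤ B)
    (decay : ∀ η > 0, ∃ ρ : ℝ, ∀ x, ρ ≤ ‖x‖ → |v x| < η) {x : E3} (hx : x ∈ exterior ε)
    (hxp : x ≠ p) : v x ≤ 0 := by
  have hpos : ∀ {y}, y ≠ p → 0 < ‖y - p‖ := fun h => norm_pos_iff.2 (sub_ne_zero.2 h)
  have key : ∀ ζ > 0, v x - ζ * ‖x - p‖⁻¹ ≤ 0 := by
    intro ζ hζ
    have hUo : IsOpen (exterior ε ∩ {p}ᶜ) := (isOpen_exterior ε).inter isOpen_compl_singleton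
    have hcont : ∀ y, y ≠ p → ContinuousAt (fun x => v x - ζ * ‖x - p‖⁻¹) y := by
      intro y hy
      have := (hpos hy).ne'
      exact (cont y hy).sub (by fun_prop (disch := assumption))
    refine max_principle (U := exterior ε ∩ {p}ᶜ) hUo (f := fun x => v x - ζ * ‖x - p‖⁻¹)
      (fun y hy => (hcont y hy.2).continuousWithinAt) ?_ ?_ ?_ x ⟨hx, hxp⟩
    · intro y hy
      refine ⟨0, le_rfl, ?_⟩
      simpa using (lap y hy.1 hy.2).sub ((hasLap_inv_norm hy.2).const_mul ζ)
    · intro y hy η hη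
      by_cases hyp : y = p
      · subst hyp
        obtain ⟨B, hB⟩ := bdd
        have h1 : 𝓝[exterior ε ∩ {y}ᶜ] y ≤ 𝓝[≠] y := nhdsWithin_mono _ fun z hz => hz.2
        have h2 : ∀ᶠ z in 𝓝 y, ‖z - y‖ * (|B| + 1) < ζ := by
          have : Continuous fun z : E3 => ‖z - y‖ * (|B| + 1) := by fun_prop
          exact (this.tendsto y).eventually (gt_mem_nhds (by simpa using hζ))
        filter_upwards [h1 hB, nhdsWithin_le_nhds h2, self_mem_nhdsWithin] with z hz1 hz2 hz3
        have hz4 := hpos hz3.2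
        have : |B| + 1 < ζ * ‖z - y‖⁻¹ := by
          rw [← div_eq_mul_inv, lt_div_iff₀ hz4]; linarith
        have := le_abs_self B
        linarith
      · refine nhdsWithin_le_nhds ((hcont y hyp).eventually (gt_mem_nhds (lt_of_le_of_lt ?_ hη)))
        have hn : y ∉ exterior ε := by
          intro h
          have := hy.2
          rw [hUo.interior_eq] at this
          exact this ⟨h, hyp⟩
        simp only [zero y hn]
        have := hpos hyp
        have : 0 ≤ ζ * ‖y - p‖⁻¹ := by positivity
        linarith
    · intro η hη
      obtain ⟨ρ, hρ⟩ := decay η hη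
      refine ⟨ρ, fun y hy h => ?_⟩
      have h1 := (abs_lt.1 (hρ y h)).2
      have : 0 ≤ ζ * ‖y - p‖⁻¹ := by positivity
      linarith
  by_contra! h
  have := key (v x / 2 * ‖x - p‖) (mul_pos (by linarith) (hpos hxp))
  rw [mul_assoc, mul_inv_cancel₀ (hpos hxp).ne'] at this
  linarith

namespace IsZeroExt

variable {ε t : ℝ} {k : Fin 3} {R : E3 → ℝ}

lemma sing_odd (hR : IsZeroExt ε t k R) (hk : k ≠ 2) : ∃ h : E3 → ℝ, ContinuousAt h (axisPt t) ∧
    (∀ᶠ x in 𝓝[≠] (axisPt t), R x = dip (edir k) (axisPt t) x + h x) ∧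
    ∀ᶠ x in 𝓝[≠] (axisPt t), R x + R (mirror k 0 x) = h x + h (mirror k 0 x) := by
  obtain ⟨h, hc, he⟩ := hR.sing
  refine ⟨h, hc, he, ?_⟩
  have hm : Tendsto (mirror k 0) (𝓝[≠] (axisPt t)) (𝓝[≠] (axisPt t)) := by
    apply tendsto_nhdsWithin_of_tendsto_nhds_of_eventually_within
    · have := (continuous_mirror k 0).tendsto (axisPt t)
      rw [mirror_axisPt hk] at this
      exact this.mono_left nhdsWithin_le_nhds
    · filter_upwards [self_mem_nhdsWithin] with x hx using mirror_ne_axisPt hk hx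
  filter_upwards [he, hm.eventually he] with x h1 h2
  rw [h1, h2, dip_mirror hk]; ring

lemma tendsto_add_mirror {h : E3 → ℝ} (hk : k ≠ 2) (hc : ContinuousAt h (axisPt t)) :
    Tendsto (fun x => h x + h (mirror k 0 x)) (𝓝 (axisPt t)) (𝓝 (2 * h (axisPt t))) := by
  have h1 : Tendsto (fun x => h (mirror k 0 x)) (𝓝 (axisPt t)) (𝓝 (h (axisPt t))) := by
    have := (continuous_mirror k 0).tendsto (axisPt t)
    rw [mirror_axisPt hk] at this
    exact hc.tendsto.comp this
  rw [two_mul]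
  exact hc.tendsto.add h1

lemma odd (hR : IsZeroExt ε t k R) (hk : k ≠ 2) {x : E3} (hxp : x ≠ axisPt t) :
    R (mirror k 0 x) = -R x := by
  have hmem : ∀ y, y ∉ exterior ε → mirror k 0 y ∉ exterior ε := by
    intro y hy hm
    have := mirror_mem_exterior (k := k) hm
    rw [mirror_mirror] at this
    exact hy this
  by_cases hx : x ∈ exterior ε
  swap
  · rw [hR.zero x hx, hR.zero _ (hmem x hx), neg_zero]
  obtain ⟨h, hc, -, he⟩ := hR.sing_odd hk
  have hten := tendsto_add_mirror hk hc
  set v : E3 → ℝ := fun x => R x + R (mirror k 0 x) with hv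
  have lap : ∀ x ∈ exterior ε, x ≠ axisPt t → HasLap v x 0 := by
    intro y hy hyp
    simpa using (hR.lap y hy hyp).add
      (hR.lap _ (mirror_mem_exterior (k := k) hy) (mirror_ne_axisPt hk hyp)).comp_mirror
  have cont : ∀ x, x ≠ axisPt t → ContinuousAt v x := by
    intro y hyp
    exact (hR.cont y hyp).add (ContinuousAt.comp (hR.cont _ (mirror_ne_axisPt hk hyp))
      (continuous_mirror _ _).continuousAt)
  have zero : ∀ x, x ∉ exterior ε → v x = 0 := by
    intro y hy
    simp only [hv, hR.zero y hy, hR.zero _ (hmem y hy), add_zero]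
  have decay : ∀ η > 0, ∃ ρ : ℝ, ∀ x, ρ ≤ ‖x‖ → |v x| < η := by
    intro η hη
    obtain ⟨ρ, hρ⟩ := hR.decay (η / 2) (by positivity)
    refine ⟨ρ, fun y hy => ?_⟩
    have hn : ‖mirror k 0 y‖ = ‖y‖ := by
      have := norm_mirror_sub_mirror k 0 y 0
      have h0 : mirror k 0 (0 : E3) = 0 := mirror_eq_self rfl
      rwa [h0, sub_zero, sub_zero] at this
    have h1 := hρ y hy
    have h2 := hρ (mirror k 0 y) (by rwa [hn])
    have := abs_add_le (R y) (R (mirror k 0 y))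
    simp only [hv]
    linarith
  have h1 : v x ≤ 0 := by
    refine nonpos_of_bounded_near lap cont zero ⟨2 * h (axisPt t) + 1, ?_⟩ decay hx hxp
    have := nhdsWithin_le_nhds (s := {axisPt t}ᶜ) (hten.eventually (gt_mem_nhds (lt_add_one _)))
    filter_upwards [he, this] with y h3 h4
    simp only [hv, h3]
    exact h4.le
  have h2 : -v x ≤ 0 := by
    refine nonpos_of_bounded_near (v := fun x => -v x) (fun y hy hyp => (lap y hy hyp).neg)
      (fun y hyp => (cont y hyp).neg) (fun y hy => by rw [zero y hy, neg_zero])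
      ⟨-(2 * h (axisPt t) - 1), ?_⟩ (fun η hη => ?_) hx hxp
    · have := nhdsWithin_le_nhds (s := {axisPt t}ᶜ) (hten.eventually (lt_mem_nhds (sub_one_lt _)))
      filter_upwards [he, this] with y h3 h4
      simp only [hv, h3]
      linarith
    · simpa only [abs_neg] using decay η hη
  have : v x = 0 := by linarith
  simp only [hv] at this
  linarith

lemma eq_zero_of_coord_eq_zero (hR : IsZeroExt ε t k R) (hk : k ≠ 2) {x : E3}
    (hxp : x ≠ axisPt t) (hx : x k = 0) : R x = 0 := by
  have := hR.odd hk hxp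
  rw [mirror_eq_self hx] at this
  linarith

lemma nonneg_and_le_dip (hR : IsZeroExt ε t k R) (hk : k ≠ 2) {x : E3} (hx : 0 < x k) :
    0 ≤ R x ∧ R x ≤ dip (edir k) (axisPt t) x := by
  by_cases hxo : x ∈ exterior ε
  swap
  · rw [hR.zero x hxo]; exact ⟨le_rfl, dip_nonneg hk t hx.le⟩
  obtain ⟨h, hc, hs, he⟩ := hR.sing_odd hk
  have hten := tendsto_add_mirror hk hc
  have hp0 : h (axisPt t) = 0 := by
    have h1 : Tendsto (fun x => h x + h (mirror k 0 x)) (𝓝[≠] (axisPt t)) (𝓝 0) := by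
      apply tendsto_const_nhds.congr'
      filter_upwards [he, self_mem_nhdsWithin] with y h2 h3
      rw [← h2, hR.odd hk h3]; ring
    have := tendsto_nhds_unique (hten.mono_left nhdsWithin_le_nhds) h1
    linarith
  have hk0 : IsOpen {x : E3 | 0 < x k} := isOpen_lt (by fun_prop) (by fun_prop)
  have hk1 : IsClosed {x : E3 | 0 ≤ x k} := isClosed_le (by fun_prop) (by fun_prop)
  set U : Set E3 := exterior ε ∩ {x | 0 < x k} with hU
  have hUo : IsOpen U := (isOpen_exterior ε).inter hk0
  have hcl : ∀ y ∈ closure U, 0 ≤ y k := by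
    intro y hy
    have : closure U ⊆ {y | 0 ≤ y k} :=
      closure_minimal (fun z hz => le_of_lt (show 0 < z k from hz.2)) hk1
    exact this hy
  have hUp : ∀ y ∈ U, y ≠ axisPt t := by
    rintro y hy rfl
    have := hy.2
    simp [axisPt_apply, hk] at this
  have hfr : ∀ y ∈ frontier U, y ≠ axisPt t → R y = 0 := by
    intro y hy hyp
    by_cases hyo : y ∈ exterior ε
    · apply hR.eq_zero_of_coord_eq_zero hk hyp
      have h1 := hcl y (frontier_subset_closure hy)
      have h2 := hy.2
      rw [hUo.interior_eq] at h2
      by_contra hne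
      exact h2 ⟨hyo, lt_of_le_of_ne h1 (Ne.symm hne)⟩
    · exact hR.zero y hyo
  have hsU : ∀ᶠ x in 𝓝[U] (axisPt t), R x = dip (edir k) (axisPt t) x + h x :=
    nhdsWithin_mono _ (fun y hy => hUp y hy) hs
  have hxU : x ∈ U := ⟨hxo, hx⟩
  constructor
  · have := max_principle hUo (f := fun x => -R x)
      (fun y hy => (hR.cont y (hUp y hy)).neg.continuousWithinAt)
      (fun y hy => ⟨0, le_rfl, (hR.lap y hy.1 (hUp y hy)).neg⟩) ?_ ?_ x hxU
    · linarith
    · intro y hy η hη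
      by_cases hyp : y = axisPt t
      · subst hyp
        have h1 : ∀ᶠ x in 𝓝 (axisPt t), -η < h x :=
          hc.eventually (lt_mem_nhds (by rw [hp0]; linarith))
        filter_upwards [hsU, nhdsWithin_le_nhds h1, self_mem_nhdsWithin] with z h2 h3 h4
        have := dip_nonneg hk t (le_of_lt h4.2)
        rw [h2]; linarith
      · exact nhdsWithin_le_nhds ((hR.cont y hyp).neg.eventually
          (gt_mem_nhds (by simpa [hfr y hy hyp] using hη)))
    · intro η hη
      obtain ⟨ρ, hρ⟩ := hR.decay η hη
      refine ⟨ρ, fun y _ h => ?_⟩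
      have := (abs_lt.1 (hρ y h)).1
      linarith
  · have := max_principle hUo (f := fun x => R x - dip (edir k) (axisPt t) x)
      (fun y hy => ((hR.cont y (hUp y hy)).sub
        (continuousAt_dip hk (hUp y hy))).continuousWithinAt)
      (fun y hy => ⟨0, le_rfl, by
        simpa using (hR.lap y hy.1 (hUp y hy)).sub (hasLap_dip k (hUp y hy))⟩) ?_ ?_ x hxU
    · linarith
    · intro y hy η hη
      by_cases hyp : y = axisPt t
      · subst hyp
        have h1 : ∀ᶠ x in 𝓝 (axisPt t), h x < η := hc.eventually (gt_mem_nhds (by rwa [hp0]))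
        filter_upwards [hsU, nhdsWithin_le_nhds h1] with z h2 h3
        rw [h2]; linarith
      · refine nhdsWithin_le_nhds (((hR.cont y hyp).sub (continuousAt_dip hk hyp)).eventually
          (gt_mem_nhds (lt_of_le_of_lt ?_ hη)))
        have := dip_nonneg hk t (hcl y (frontier_subset_closure hy))
        simp only [Pi.sub_apply, hfr y hy hyp]
        linarith
    · intro η hη
      obtain ⟨ρ, hρ⟩ := hR.decay η hη
      refine ⟨ρ, fun y hy h => ?_⟩
      have := (abs_lt.1 (hρ y h)).2
      have := dip_nonneg hk t (le_of_lt hy.2)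
      linarith

lemma abs_le_of_pos (hR : IsZeroExt ε t k R) (hk : k ≠ 2) {x : E3} (hxp : x ≠ axisPt t) {B : ℝ}
    (hB : 0 ≤ B) (hpos : ∀ y : E3, ‖y - axisPt t‖ = ‖x - axisPt t‖ → 0 < y k → R y ≤ B) :
    |R x| ≤ B := by
  rcases lt_trichotomy (x k) 0 with h | h | h
  · have h1 := hpos (mirror k 0 x) (norm_mirror_sub_axisPt hk t x)
      (by rw [mirror_apply_self]; linarith)
    have h2 := (hR.nonneg_and_le_dip hk (x := mirror k 0 x) (by rw [mirror_apply_self]; linarith)).1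
    rw [hR.odd hk hxp] at h1 h2
    rwa [abs_of_nonpos (by linarith)]
  · rw [hR.eq_zero_of_coord_eq_zero hk hxp h, abs_zero]; exact hB
  · rw [abs_of_nonneg (hR.nonneg_and_le_dip hk h).1]; exact hpos x rfl h

lemma abs_le_inv_sq (hR : IsZeroExt ε t k R) (hk : k ≠ 2) {x : E3} (hxp : x ≠ axisPt t) :
    |R x| ≤ 1 / ‖x - axisPt t‖ ^ 2 :=
  hR.abs_le_of_pos hk hxp (by positivity) fun y hy hyk => by
    rw [← hy]; exact (hR.nonneg_and_le_dip hk hyk).2.trans (dip_le k t y)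

end IsZeroExt

lemma le_linear_near_sphere {ε s M : ℝ} {c z : E3} {v : E3 → ℝ} (hs : 0 < s) (hs1 : s ≤ 1)
    (hc : ∀ y ∈ closure (exterior ε), 1 ≤ ‖y - c‖) (hz : z ∈ exterior ε)
    (hz1 : 1 < ‖z - c‖) (hM0 : 0 ≤ M)
    (lap : ∀ y ∈ exterior ε, ‖y - z‖ ≤ 4 * s → HasLap v y 0)
    (cont : ∀ y, ‖y - z‖ ≤ 4 * s → ContinuousAt v y)
    (zero : ∀ y, y ∉ exterior ε → v y = 0) (hM : ∀ y, ‖y - z‖ ≤ 4 * s → v y ≤ M) :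
    v z ≤ 2 * M * (‖z - c‖ - 1) / s := by
  set n := ‖z - c‖ with hn
  rcases le_or_gt s (n - 1) with hτ | hτ
  · refine (hM z (by simp; linarith)).trans ?_
    rw [le_div_iff₀ hs]
    nlinarith
  have hn0 : 0 < n := by linarith
  set c' : E3 := c + ((1 - s) / n) • (z - c) with hc'
  have h1 : ‖c' - c‖ = 1 - s := by
    rw [hc', add_sub_cancel_left, norm_smul, ← hn, Real.norm_of_nonneg
      (div_nonneg (by linarith) hn0.le), div_mul_cancel₀ _ hn0.ne']
  have h2 : ‖z - c'‖ = n - 1 + s := by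
    have : z - c' = (1 - (1 - s) / n) • (z - c) := by rw [hc', sub_smul, one_smul]; abel
    have h3 : (1 - s) / n ≤ 1 := by rw [div_le_one hn0]; linarith
    rw [this, norm_smul, ← hn, Real.norm_of_nonneg (by linarith)]
    field_simp; ring
  have hfar : ∀ y ∈ closure (exterior ε), s ≤ ‖y - c'‖ := by
    intro y hy
    have := hc y hy
    have h3 : ‖y - c‖ ≤ ‖y - c'‖ + ‖c' - c‖ := norm_sub_le_norm_sub_add_norm_sub _ _ _
    linarith
  have hnear : ∀ y, ‖y - c'‖ ≤ 2 * s → ‖y - z‖ ≤ 4 * s := by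
    intro y hy
    have h3 : ‖y - z‖ ≤ ‖y - c'‖ + ‖c' - z‖ := norm_sub_le_norm_sub_add_norm_sub _ _ _
    rw [norm_sub_rev c' z] at h3
    linarith
  have hball : IsOpen {y : E3 | ‖y - c'‖ < 2 * s} := isOpen_lt (by fun_prop) (by fun_prop)
  have hcball : IsClosed {y : E3 | ‖y - c'‖ ≤ 2 * s} := isClosed_le (by fun_prop) (by fun_prop)
  set U : Set E3 := exterior ε ∩ {y | ‖y - c'‖ < 2 * s} with hU
  have hUo : IsOpen U := (isOpen_exterior ε).inter hball
  have hcl1 : closure U ⊆ closure (exterior ε) := closure_mono Set.inter_subset_left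
  have hcl2 : ∀ y ∈ closure U, ‖y - c'‖ ≤ 2 * s := by
    intro y hy
    have : closure U ⊆ {y : E3 | ‖y - c'‖ ≤ 2 * s} :=
      closure_minimal (fun y hy => le_of_lt (show ‖y - c'‖ < 2 * s from hy.2)) hcball
    exact this hy
  have key := max_principle_bounded (U := U) hUo
    ((Metric.isBounded_ball (x := c') (r := 2 * s)).subset fun y hy => by
      rw [mem_ball, dist_eq_norm]; exact hy.2)
    (f := fun y => v y - 2 * M * (1 - s * ‖y - c'‖⁻¹)) ?_ ?_ ?_ z
    ⟨hz, show ‖z - c'‖ < 2 * s by linarith⟩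
  · have h4 : 2 * M * (1 - s * ‖z - c'‖⁻¹) ≤ 2 * M * (n - 1) / s := by
      rw [h2, mul_div_assoc]
      have hpos : 0 < n - 1 + s := by linarith
      have : 1 - s * (n - 1 + s)⁻¹ = (n - 1) / (n - 1 + s) := by field_simp; ring
      rw [this]
      gcongr
      linarith
    linarith
  · intro y hy
    have h4 : ‖y - c'‖ ≠ 0 := by linarith [hfar y (hcl1 hy)]
    exact (cont y (hnear y (hcl2 y hy))).sub (by fun_prop (disch := assumption))
  · intro y hy
    refine ⟨0, le_rfl, ?_⟩
    have hy2 : y ≠ c' := by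
      intro h
      have := hfar y (subset_closure hy.1)
      rw [h, sub_self, norm_zero] at this
      linarith
    have h4 := (((hasLap_const 1 y).sub ((hasLap_inv_norm hy2).const_mul s)).const_mul (2 * M))
    simpa using (lap y hy.1 (hnear y (hcl2 y (subset_closure hy)))).sub h4
  · intro y hy
    have hycl := frontier_subset_closure hy
    have h4 := hfar y (hcl1 hycl)
    have h5 : 0 ≤ 1 - s * ‖y - c'‖⁻¹ := by
      rw [← div_eq_mul_inv, sub_nonneg, div_le_one (by linarith)]; exact h4
    show v y - 2 * M * (1 - s * ‖y - c'‖⁻¹) ≤ 0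
    by_cases hyo : y ∈ exterior ε
    · have h6 : ‖y - c'‖ = 2 * s := by
        apply le_antisymm (hcl2 y hycl)
        by_contra! h
        have := hy.2
        rw [hUo.interior_eq] at this
        exact this ⟨hyo, h⟩
      have h7 := hM y (hnear y h6.le)
      have h8 : 1 - s * (2 * s)⁻¹ = 1 / 2 := by field_simp; ring
      rw [h6, h8]
      linarith
    · rw [zero y hyo]
      have : 0 ≤ 2 * M * (1 - s * ‖y - c'‖⁻¹) := by positivity
      linarith

lemma mem_exterior_of_far {ε t : ℝ} (hε : 0 < ε) (hε1 : ε ≤ 1) (ht : |t| ≤ 1 / 2) {x : E3}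
    (hx : 3 < ‖x - axisPt t‖) : x ∈ exterior ε := by
  have ht2 : t ^ 2 ≤ 1 / 4 := by
    have := sq_le_sq' (abs_le.1 ht).1 (abs_le.1 ht).2
    norm_num at this ⊢; exact this
  have h1 : ‖axisPt t - ctr1 ε‖ ≤ 2 := by
    apply le_of_sq_le_sq _ (by norm_num)
    rw [norm_sub_ctr1_sq]; simp [axisPt_apply]; nlinarith
  have h2 : ‖axisPt t - ctr2 ε‖ ≤ 2 := by
    apply le_of_sq_le_sq _ (by norm_num)
    rw [norm_sub_ctr2_sq]; simp [axisPt_apply]; nlinarith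
  have h3 : ∀ c : E3, ‖x - axisPt t‖ ≤ ‖x - c‖ + ‖axisPt t - c‖ := fun c => by
    rw [norm_sub_rev (axisPt t) c]; exact norm_sub_le_norm_sub_add_norm_sub _ _ _
  exact ⟨by linarith [h3 (ctr1 ε)], by linarith [h3 (ctr2 ε)]⟩

namespace IsZeroExt

variable {ε t : ℝ} {k : Fin 3} {R : E3 → ℝ}

lemma abs_le_linear_near_sphere (hR : IsZeroExt ε t k R) {s M : ℝ} {c z : E3} (hs : 0 < s)
    (hs1 : s ≤ 1) (hc : ∀ y ∈ closure (exterior ε), 1 ≤ ‖y - c‖) (hz : z ∈ exterior ε)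
    (hz1 : 1 < ‖z - c‖) (hp : 4 * s < ‖z - axisPt t‖)
    (hM : ∀ y, ‖y - z‖ ≤ 4 * s → |R y| ≤ M) :
    |R z| ≤ 2 * M * (‖z - c‖ - 1) / s := by
  have hM0 : 0 ≤ M := (abs_nonneg _).trans (hM z (by simp; linarith))
  have hne : ∀ y, ‖y - z‖ ≤ 4 * s → y ≠ axisPt t := by
    rintro y hy rfl
    rw [norm_sub_rev] at hy
    linarith
  rw [abs_le']
  constructor
  · exact le_linear_near_sphere hs hs1 hc hz hz1 hM0 (fun y hy h => hR.lap y hy (hne y h))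
      (fun y h => hR.cont y (hne y h)) hR.zero (fun y h => (abs_le'.1 (hM y h)).1)
  · exact le_linear_near_sphere (v := fun y => -R y) hs hs1 hc hz hz1 hM0
      (fun y hy h => (hR.lap y hy (hne y h)).neg) (fun y h => (hR.cont y (hne y h)).neg)
      (fun y hy => by rw [hR.zero y hy, neg_zero]) (fun y h => (abs_le'.1 (hM y h)).2)

lemma norm_gradient_le_of_abs_le (hR : IsZeroExt ε t k R) (hε : 0 < ε) (hε1 : ε ≤ 1)
    (ht : |t| ≤ 1 / 2) {x : E3} (hx : x ∈ exterior ε) (hxp : x ≠ axisPt t) {M : ℝ}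
    (hM : ∀ y, ‖x - axisPt t‖ / 2 ≤ ‖y - axisPt t‖ → |R y| ≤ M) :
    ‖gradient R x‖ ≤ 2160 * M / ‖x - axisPt t‖ := by
  set d := ‖x - axisPt t‖ with hd
  have hd0 : 0 < d := norm_pos_iff.2 (sub_ne_zero.2 hxp)
  have hM0 : 0 ≤ M := (abs_nonneg _).trans (hM x (by linarith))
  have htri : ∀ y, d - ‖y - x‖ ≤ ‖y - axisPt t‖ := by
    intro y
    have := norm_sub_le_norm_sub_add_norm_sub x y (axisPt t)
    rw [norm_sub_rev x y] at this
    linarith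
  have hne : ∀ y, d / 2 ≤ ‖y - axisPt t‖ → y ≠ axisPt t := by
    rintro y hy rfl
    simp at hy
    linarith
  have hgen : ∀ ρ > 0, ρ ≤ d / 2 → (∀ y, ‖y - x‖ ≤ ρ → y ∈ exterior ε) → ∀ B,
      (∀ y, ‖y - x‖ ≤ ρ → |R y| ≤ B) → ‖gradient R x‖ ≤ 9 * B / ρ := by
    intro ρ hρ hρd hext B hB
    have hh : ∀ y, ‖y - x‖ ≤ ρ → d / 2 ≤ ‖y - axisPt t‖ := fun y hy => by linarith [htri y]
    exact norm_gradient_le hρ (fun y hy => hR.cont y (hne y (hh y hy)))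
      (fun y hy => hR.lap y (hext y hy) (hne y (hh y hy))) hB
  have hMd : 0 ≤ M / d := by positivity
  rcases lt_or_ge 20 d with h20 | h20
  · have := hgen (d / 2) (by positivity) le_rfl (fun y hy =>
      mem_exterior_of_far hε hε1 ht (by linarith [htri y])) M
      (fun y hy => hM y (by linarith [htri y]))
    have h1 : 9 * M / (d / 2) = 18 * (M / d) := by field_simp; ring
    have h2 : 2160 * M / d = 2160 * (M / d) := by ring
    linarith
  set s := d / 40 with hs
  have hs0 : 0 < s := by positivity
  obtain ⟨c, hc, hxc, hmin1, hmin2⟩ : ∃ c : E3, (∀ y ∈ closure (exterior ε), 1 ≤ ‖y - c‖) ∧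
      1 < ‖x - c‖ ∧ ‖x - c‖ ≤ ‖x - ctr1 ε‖ ∧ ‖x - c‖ ≤ ‖x - ctr2 ε‖ := by
    rcases le_total ‖x - ctr1 ε‖ ‖x - ctr2 ε‖ with h | h
    · exact ⟨ctr1 ε, fun y hy => (closure_exterior_subset ε hy).1, hx.1, le_rfl, h⟩
    · exact ⟨ctr2 ε, fun y hy => (closure_exterior_subset ε hy).2, hx.2, h, le_rfl⟩
  set δ := ‖x - c‖ - 1 with hδ
  have hδ0 : 0 < δ := by linarith
  have hext : ∀ y, ‖y - x‖ ≤ δ / 2 → y ∈ exterior ε := by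
    intro y hy
    have h : ∀ b : E3, ‖x - b‖ ≤ ‖y - x‖ + ‖y - b‖ := fun b => by
      rw [norm_sub_rev y x]; exact norm_sub_le_norm_sub_add_norm_sub _ _ _
    exact ⟨by linarith [h (ctr1 ε)], by linarith [h (ctr2 ε)]⟩
  have h2 : 2160 * M / d = 54 * M / s := by rw [hs]; field_simp; ring
  rw [h2]
  rcases le_or_gt s δ with hsδ | hsδ
  · have := hgen (s / 2) (by positivity) (by linarith) (fun y hy => hext y (by linarith)) M
      (fun y hy => hM y (by linarith [htri y]))
    have h1 : 9 * M / (s / 2) = 18 * M / s := by field_simp; ring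
    have h3 : 18 * M / s ≤ 54 * M / s := by gcongr; norm_num
    linarith
  · have := hgen (δ / 2) (by positivity) (by linarith) hext (3 * M * δ / s) (fun z hz => ?_)
    · have h1 : 9 * (3 * M * δ / s) / (δ / 2) = 54 * M / s := by field_simp; ring
      linarith
    · have hz1 : ‖x - c‖ ≤ ‖z - x‖ + ‖z - c‖ := by
        rw [norm_sub_rev z x]; exact norm_sub_le_norm_sub_add_norm_sub _ _ _
      have hz2 : ‖z - c‖ ≤ ‖z - x‖ + ‖x - c‖ := norm_sub_le_norm_sub_add_norm_sub _ _ _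
      refine (hR.abs_le_linear_near_sphere (M := M) hs0 (by linarith) hc (hext z hz)
        (by linarith) (by linarith [htri z]) (fun y hy => hM y ?_)).trans ?_
      · have : ‖y - x‖ ≤ ‖y - z‖ + ‖z - x‖ := norm_sub_le_norm_sub_add_norm_sub _ _ _
        linarith [htri y]
      · have h3 : 3 * M * δ = 2 * M * (3 / 2 * δ) := by ring
        rw [h3]
        gcongr
        linarith

end IsZeroExt

lemma abs_coord_zero_le {ε : ℝ} (hε : 0 < ε) {y : E3} (hy : y ∈ closure (exterior ε))
    (h0 : |y 0| ≤ 1) (hρ1 : y 1 ^ 2 + y 2 ^ 2 ≤ 1) : |y 0| ≤ ε / 2 + (y 1 ^ 2 + y 2 ^ 2) := by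
  obtain ⟨h2, h3⟩ := closure_exterior_subset ε hy
  have h4 : 1 ≤ (y 0 + (1 + ε / 2)) ^ 2 + (y 1 ^ 2 + y 2 ^ 2) := by
    rw [← add_assoc, ← norm_sub_ctr1_sq]; exact one_le_pow₀ h2
  have h5 : 1 ≤ (y 0 - (1 + ε / 2)) ^ 2 + (y 1 ^ 2 + y 2 ^ 2) := by
    rw [← add_assoc, ← norm_sub_ctr2_sq]; exact one_le_pow₀ h3
  obtain ⟨h6, h7⟩ := abs_le.1 h0
  obtain ⟨q, hq⟩ : ∃ q, q = y 1 ^ 2 + y 2 ^ 2 := ⟨_, rfl⟩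
  have hρ : 0 ≤ q := hq ▸ by positivity
  have hq1 : q ≤ 1 := hq ▸ hρ1
  rw [← hq] at h4 h5 ⊢
  rw [abs_le]
  constructor
  · by_contra! h
    nlinarith [hq1]
  · by_contra! h
    nlinarith [hq1]

/-- The harmonic comparison function in the neck between the two balls. -/
def neckBarrier (α b₁ b₂ : ℝ) (y : E3) : ℝ :=
  Real.cos (α * y 0) * Real.cosh (α * (y 1 - b₁)) + Real.cos (α * y 0) * Real.cosh (α * (y 2 - b₂))

lemma hasLap_neckBarrier (α b₁ b₂ : ℝ) (y : E3) : HasLap (neckBarrier α b₁ b₂) y 0 := by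
  have hl : ∀ s, HasDerivAt (fun s => α * s) α s := fun s => by
    simpa using (hasDerivAt_id' s).const_mul α
  have hlb : ∀ b s, HasDerivAt (fun s => α * (s - b)) α s := fun b s => by
    simpa using ((hasDerivAt_id' s).sub_const b).const_mul α
  have hc1 : ∀ s : ℝ, HasDerivAt (fun s => Real.cos (α * s)) (-α * Real.sin (α * s)) s := fun s =>
    (hl s).cos.congr_deriv (by ring)
  have hc2 : ∀ s : ℝ, HasDerivAt (fun s => -α * Real.sin (α * s)) (-α ^ 2 * Real.cos (α * s)) s :=
    fun s => ((hl s).sin.const_mul (-α)).congr_deriv (by ring)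
  have hh1 : ∀ b s : ℝ, HasDerivAt (fun s => Real.cosh (α * (s - b)))
      (α * Real.sinh (α * (s - b))) s := fun b s => (hlb b s).cosh.congr_deriv (by ring)
  have hh2 : ∀ b s : ℝ, HasDerivAt (fun s => α * Real.sinh (α * (s - b)))
      (α ^ 2 * Real.cosh (α * (s - b))) s := fun b s =>
    ((hlb b s).sinh.const_mul α).congr_deriv (by ring)
  have := (hasLap_prod hc1 hc2 (hh1 b₁) (hh2 b₁) (j := 0) (k := 1) (by decide) y).add
    (hasLap_prod hc1 hc2 (hh1 b₂) (hh2 b₂) (j := 0) (k := 2) (by decide) y)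
  have h0 : ∀ c₀ c₁ c₂ : ℝ, -α ^ 2 * c₀ * c₁ + c₀ * (α ^ 2 * c₁) +
      (-α ^ 2 * c₀ * c₂ + c₀ * (α ^ 2 * c₂)) = 0 := fun c₀ c₁ c₂ => by ring
  rwa [h0] at this

lemma continuous_neckBarrier (α b₁ b₂ : ℝ) : Continuous (neckBarrier α b₁ b₂) := by
  unfold neckBarrier
  fun_prop

lemma neckBarrier_nonneg {α b₁ b₂ : ℝ} {y : E3} (h : |α * y 0| ≤ 1) :
    0 ≤ neckBarrier α b₁ b₂ y := by
  have : 0 ≤ Real.cos (α * y 0) :=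
    (Real.cos_pos_of_le_one h).le
  unfold neckBarrier
  positivity

lemma le_neckBarrier {α b₁ b₂ s : ℝ} {y : E3} (hα : 0 ≤ α) (h : |α * y 0| ≤ 1)
    (hy : |y 1 - b₁| = s ∨ |y 2 - b₂| = s) : Real.exp (α * s) / 4 ≤ neckBarrier α b₁ b₂ y := by
  have h1 : 1 / 2 ≤ Real.cos (α * y 0) := by
    have h2 := Real.one_sub_sq_div_two_le_cos (x := α * y 0)
    have h3 : (α * y 0) ^ 2 ≤ 1 := by rw [← sq_abs]; exact pow_le_one₀ (abs_nonneg _) h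
    linarith
  have h2 : ∀ r, |r| = s → Real.exp (α * s) / 2 ≤ Real.cosh (α * r) := by
    intro r hr
    rw [← Real.cosh_abs, abs_mul, hr, abs_of_nonneg hα, Real.cosh_eq]
    have := Real.exp_pos (-(α * s))
    linarith
  have he := Real.exp_pos (α * s)
  have h3 : ∀ r, |r| = s → Real.exp (α * s) / 4 ≤ Real.cos (α * y 0) * Real.cosh (α * r) := by
    intro r hr
    have := h2 r hr
    nlinarith
  have h4 : ∀ r, 0 ≤ Real.cos (α * y 0) * Real.cosh (α * r) := fun r => by
    have := Real.cosh_pos (α * r)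
    have : 0 ≤ Real.cos (α * y 0) := by linarith
    positivity
  unfold neckBarrier
  rcases hy with hy | hy
  · have := h3 _ hy
    have := h4 (y 2 - b₂)
    linarith
  · have := h3 _ hy
    have := h4 (y 1 - b₁)
    linarith

lemma neckBarrier_self_le (α : ℝ) (x : E3) : neckBarrier α (x 1) (x 2) x ≤ 2 := by
  have := Real.cos_le_one (α * x 0)
  simp [neckBarrier]
  linarith

lemma norm_sub_axisPt_sq (t : ℝ) (y : E3) :
    ‖y - axisPt t‖ ^ 2 = y 0 ^ 2 + y 1 ^ 2 + (y 2 - t) ^ 2 := by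
  rw [norm_sq_E3]; simp [axisPt_apply]

lemma one_div_le_exp_neg_one : (1 : ℝ) / 32 ≤ Real.exp (-1) := by
  rw [Real.exp_neg, one_div]
  apply inv_anti₀ (Real.exp_pos 1)
  linarith [Real.exp_one_lt_d9]

lemma le_neck {ε t κ : ℝ} (hε : 0 < ε) (hκ : 0 < κ) (hεκ : ε ≤ κ ^ 2) (htκ : |t| ≤ κ)
    (hκ1 : κ ≤ 1 / 20) {v : E3 → ℝ} (lap : ∀ y ∈ exterior ε, y ≠ axisPt t → HasLap v y 0)
    (cont : ∀ y, y ≠ axisPt t → ContinuousAt v y) (zero : ∀ y, y ∉ exterior ε → v y = 0)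
    (hv : ∀ y, y ≠ axisPt t → v y ≤ 1 / ‖y - axisPt t‖ ^ 2) {x : E3} (hxp : x ≠ axisPt t)
    (hxκ : ‖x - axisPt t‖ ≤ κ) :
    v x ≤ 32 / ‖x - axisPt t‖ ^ 2 * Real.exp (-(‖x - axisPt t‖ / (32 * κ ^ 2))) := by
  have hd0 : 0 < ‖x - axisPt t‖ := norm_pos_iff.2 (sub_ne_zero.2 hxp)
  have hvx := hv x hxp
  have hdsq := norm_sub_axisPt_sq t x
  set d := ‖x - axisPt t‖ with hd
  rcases le_or_gt d (32 * κ ^ 2) with hsmall | hlarge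
  · have h1 : Real.exp (-1) ≤ Real.exp (-(d / (32 * κ ^ 2))) := by
      apply Real.exp_le_exp.2
      rw [neg_le_neg_iff, div_le_one (by positivity)]
      exact hsmall
    have h2 : 1 / d ^ 2 = 32 / d ^ 2 * (1 / 32) := by ring
    rw [h2] at hvx
    refine hvx.trans ?_
    gcongr
    exact one_div_le_exp_neg_one.trans h1
  by_cases hxo : x ∈ exterior ε
  swap
  · rw [zero x hxo]; positivity
  obtain ⟨ht1, ht2⟩ := abs_le.1 htκ
  have hdκ : d ^ 2 ≤ κ ^ 2 := by gcongr
  have hκ2 : κ ^ 2 ≤ 1 / 400 := by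
    have := pow_le_pow_left₀ hκ.le hκ1 2
    norm_num at this ⊢; exact this
  have hx0 : |x 0| ≤ κ := abs_le_of_sq_le_sq (by linarith [sq_nonneg (x 1), sq_nonneg (x 2 - t)]) hκ.le
  obtain ⟨hx1, hx1'⟩ := abs_le_of_sq_le_sq' (a := x 1) (b := κ)
    (by linarith [sq_nonneg (x 0), sq_nonneg (x 2 - t)]) hκ.le
  obtain ⟨hx2, hx2'⟩ := abs_le_of_sq_le_sq' (a := x 2 - t) (b := κ)
    (by linarith [sq_nonneg (x 0), sq_nonneg (x 1)]) hκ.le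
  set s := d / 4 with hs
  have hs0 : 0 < s := by positivity
  set α := 1 / (8 * κ ^ 2) with hα
  have hα0 : 0 < α := by positivity
  have hcoord : ∀ y ∈ closure (exterior ε), |y 0| ≤ 1 → |y 1 - x 1| ≤ s → |y 2 - x 2| ≤ s →
      |y 0| ≤ 57 / 8 * κ ^ 2 := by
    intro y hy h0 h1 h2
    obtain ⟨h1, h1'⟩ := abs_le.1 h1
    obtain ⟨h2, h2'⟩ := abs_le.1 h2
    have h3 : y 1 ^ 2 ≤ (5 / 4 * κ) ^ 2 := sq_le_sq' (by linarith) (by linarith)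
    have h4 : y 2 ^ 2 ≤ (9 / 4 * κ) ^ 2 := sq_le_sq' (by linarith) (by linarith)
    have := abs_coord_zero_le hε hy h0 (by linarith)
    linarith
  have hx0' : |x 0| ≤ d / 4 := by
    have := hcoord x (subset_closure hxo) (by linarith) (by simpa using hs0.le) (by simpa using hs0.le)
    linarith
  set U : Set E3 := exterior ε ∩ {y | |y 0| < 1 ∧ |y 1 - x 1| < s ∧ |y 2 - x 2| < s} with hU
  have hUo : IsOpen U := by
    have h1 : IsOpen {y : E3 | |y 0| < 1} := isOpen_lt (by fun_prop) (by fun_prop)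
    have h2 : IsOpen {y : E3 | |y 1 - x 1| < s} := isOpen_lt (by fun_prop) (by fun_prop)
    have h3 : IsOpen {y : E3 | |y 2 - x 2| < s} := isOpen_lt (by fun_prop) (by fun_prop)
    exact (isOpen_exterior ε).inter (h1.inter (h2.inter h3))
  have hUcl : ∀ y ∈ closure U,
      y ∈ closure (exterior ε) ∧ |y 0| ≤ 1 ∧ |y 1 - x 1| ≤ s ∧ |y 2 - x 2| ≤ s := by
    have h1 : IsClosed {y : E3 | |y 0| ≤ 1} := isClosed_le (by fun_prop) (by fun_prop)
    have h2 : IsClosed {y : E3 | |y 1 - x 1| ≤ s} := isClosed_le (by fun_prop) (by fun_prop)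
    have h3 : IsClosed {y : E3 | |y 2 - x 2| ≤ s} := isClosed_le (by fun_prop) (by fun_prop)
    intro y hy
    have hsub : closure U ⊆ closure (exterior ε) ∩
        ({y | |y 0| ≤ 1} ∩ ({y | |y 1 - x 1| ≤ s} ∩ {y | |y 2 - x 2| ≤ s})) :=
      closure_minimal (fun z hz => ⟨subset_closure hz.1, le_of_lt hz.2.1, le_of_lt hz.2.2.1,
        le_of_lt hz.2.2.2⟩) (isClosed_closure.inter (h1.inter (h2.inter h3)))
    exact hsub hy
  have hαy : ∀ y ∈ closure U, |α * y 0| ≤ 1 := by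
    intro y hy
    obtain ⟨h1, h2, h3, h4⟩ := hUcl y hy
    have := hcoord y h1 h2 h3 h4
    rw [abs_mul, abs_of_pos hα0, hα, one_div, inv_mul_le_iff₀ (by positivity)]
    linarith
  have hfar : ∀ y ∈ closure U, d / 2 ≤ ‖y - axisPt t‖ := by
    intro y hy
    obtain ⟨-, -, h3, h4⟩ := hUcl y hy
    apply le_of_sq_le_sq _ (norm_nonneg _)
    rw [norm_sub_axisPt_sq]
    have h5 : x 0 ^ 2 ≤ (d / 4) ^ 2 := sq_le_sq' (abs_le.1 hx0').1 (abs_le.1 hx0').2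
    have h6 : (y 1 - x 1) ^ 2 ≤ s ^ 2 := sq_le_sq' (abs_le.1 h3).1 (abs_le.1 h3).2
    have h7 : (y 2 - x 2) ^ 2 ≤ s ^ 2 := sq_le_sq' (abs_le.1 h4).1 (abs_le.1 h4).2
    have h8 : x 1 ^ 2 / 2 ≤ y 1 ^ 2 + (y 1 - x 1) ^ 2 := by
      linarith [sq_nonneg (y 1 + (y 1 - x 1))]
    have h9 : (x 2 - t) ^ 2 / 2 ≤ (y 2 - t) ^ 2 + (y 2 - x 2) ^ 2 := by
      linarith [sq_nonneg ((y 2 - t) + (y 2 - x 2))]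
    have h10 : s ^ 2 = d ^ 2 / 16 := by rw [hs]; ring
    linarith [sq_nonneg (y 0), sq_nonneg d]
  have hne : ∀ y ∈ closure U, y ≠ axisPt t := by
    intro y hy h
    have := hfar y hy
    rw [h, sub_self, norm_zero] at this
    linarith
  set N := 16 / d ^ 2 * Real.exp (-(α * s)) with hN
  have hxU : x ∈ U := ⟨hxo, show |x 0| < 1 by linarith, by simpa using hs0, by simpa using hs0⟩
  have hbdd : Bornology.IsBounded U := by
    refine (Metric.isBounded_ball (x := axisPt t) (r := 2)).subset fun y hy => ?_
    rw [mem_ball, dist_eq_norm]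
    apply lt_of_pow_lt_pow_left₀ 2 (by norm_num)
    rw [norm_sub_axisPt_sq]
    obtain ⟨-, h1, h2, h3⟩ := hy
    obtain ⟨h1, h1'⟩ := abs_lt.1 h1
    obtain ⟨h2, h2'⟩ := abs_lt.1 h2
    obtain ⟨h3, h3'⟩ := abs_lt.1 h3
    have hsq : ∀ r : ℝ, -1 < r → r < 1 → r ^ 2 < 1 := fun r h h' =>
      (sq_lt_one_iff_abs_lt_one r).2 (abs_lt.2 ⟨h, h'⟩)
    have h4 := hsq (y 0) h1 h1'
    have h5 := hsq (y 1) (by linarith) (by linarith)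
    have h6 := hsq (y 2 - t) (by linarith) (by linarith)
    linarith
  have key := max_principle_bounded hUo hbdd (f := fun y => v y - N * neckBarrier α (x 1) (x 2) y)
    (fun y hy => (cont y (hne y hy)).sub
      (continuous_const.mul (continuous_neckBarrier α (x 1) (x 2))).continuousAt)
    (fun y hy => ⟨0, le_rfl, by
      simpa using (lap y hy.1 (hne y (subset_closure hy))).sub
        ((hasLap_neckBarrier α (x 1) (x 2) y).const_mul N)⟩) ?_ x hxU
  · have h1 := neckBarrier_self_le α x
    have h2 : 0 ≤ N := by positivity
    have h3 : α * s = d / (32 * κ ^ 2) := by rw [hα, hs]; field_simp; norm_num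
    rw [← h3]
    have h4 : 32 / d ^ 2 * Real.exp (-(α * s)) = N * 2 := by rw [hN]; ring
    rw [h4]
    have := mul_le_mul_of_nonneg_left h1 h2
    linarith
  · intro y hy
    have hycl := frontier_subset_closure hy
    show v y - N * neckBarrier α (x 1) (x 2) y ≤ 0
    have h2 : 0 ≤ N := by positivity
    by_cases hyo : y ∈ exterior ε
    swap
    · rw [zero y hyo]
      have := neckBarrier_nonneg (b₁ := x 1) (b₂ := x 2) (hαy y hycl)
      have := mul_nonneg h2 this
      linarith
    obtain ⟨h3, h4, h5, h6⟩ := hUcl y hycl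
    have hside : |y 1 - x 1| = s ∨ |y 2 - x 2| = s := by
      by_contra! h
      have h7 := hy.2
      rw [hUo.interior_eq] at h7
      have := hcoord y h3 h4 h5 h6
      exact h7 ⟨hyo, show |y 0| < 1 by linarith, lt_of_le_of_ne h5 h.1, lt_of_le_of_ne h6 h.2⟩
    have h7 := mul_le_mul_of_nonneg_left (le_neckBarrier hα0.le (hαy y hycl) hside) h2
    have h8 : N * (Real.exp (α * s) / 4) = 4 / d ^ 2 := by
      rw [hN, Real.exp_neg]; field_simp; norm_num
    have h9 : 1 / ‖y - axisPt t‖ ^ 2 ≤ 4 / d ^ 2 := by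
      have : 1 / (d / 2) ^ 2 = 4 / d ^ 2 := by field_simp; norm_num
      rw [← this]
      have := hfar y hycl
      gcongr
    have := hv y (hne y hycl)
    linarith

namespace IsZeroExt

variable {ε t : ℝ} {k : Fin 3} {R : E3 → ℝ}

lemma abs_le_neck (hR : IsZeroExt ε t k R) (hk : k ≠ 2) {κ : ℝ} (hε : 0 < ε) (hκ : 0 < κ)
    (hεκ : ε ≤ κ ^ 2) (htκ : |t| ≤ κ) (hκ1 : κ ≤ 1 / 20) {x : E3} (hxp : x ≠ axisPt t)
    (hxκ : ‖x - axisPt t‖ ≤ κ) :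
    |R x| ≤ 32 / ‖x - axisPt t‖ ^ 2 * Real.exp (-(‖x - axisPt t‖ / (32 * κ ^ 2))) := by
  rw [abs_le']
  constructor
  · exact le_neck hε hκ hεκ htκ hκ1 hR.lap hR.cont hR.zero
      (fun y hy => (abs_le'.1 (hR.abs_le_inv_sq hk hy)).1) hxp hxκ
  · exact le_neck (v := fun y => -R y) hε hκ hεκ htκ hκ1 (fun y hy h => (hR.lap y hy h).neg)
      (fun y h => (hR.cont y h).neg) (fun y hy => by rw [hR.zero y hy, neg_zero])
      (fun y hy => (abs_le'.1 (hR.abs_le_inv_sq hk hy)).2) hxp hxκ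

end IsZeroExt

lemma le_of_le_on_sphere {ε t κ M : ℝ} {v : E3 → ℝ} (hκ : 0 < κ) (hM0 : 0 ≤ M)
    (lap : ∀ y ∈ exterior ε, y ≠ axisPt t → HasLap v y 0)
    (cont : ∀ y, y ≠ axisPt t → ContinuousAt v y) (zero : ∀ y, y ∉ exterior ε → v y = 0)
    (decay : ∀ η > 0, ∃ ρ : ℝ, ∀ x, ρ ≤ ‖x‖ → |v x| < η)
    (hM : ∀ y, ‖y - axisPt t‖ = κ → v y ≤ M) {x : E3} (hx : κ ≤ ‖x - axisPt t‖) : v x ≤ M := by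
  rcases hx.eq_or_lt with hx | hx
  · exact hM x hx.symm
  by_cases hxo : x ∈ exterior ε
  swap
  · rwa [zero x hxo]
  have h1 : IsOpen {y : E3 | κ < ‖y - axisPt t‖} := isOpen_lt (by fun_prop) (by fun_prop)
  have h2 : IsClosed {y : E3 | κ ≤ ‖y - axisPt t‖} := isClosed_le (by fun_prop) (by fun_prop)
  have hUo := (isOpen_exterior ε).inter h1
  have hcl : closure (exterior ε ∩ {y : E3 | κ < ‖y - axisPt t‖}) ⊆ {y | κ ≤ ‖y - axisPt t‖} :=
    closure_minimal (fun y hy => show κ ≤ ‖y - axisPt t‖ from le_of_lt hy.2) h2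
  have hne : ∀ y, κ ≤ ‖y - axisPt t‖ → y ≠ axisPt t := by
    intro y hy h
    rw [h, sub_self, norm_zero] at hy
    linarith
  have hc : ∀ y, κ ≤ ‖y - axisPt t‖ → ContinuousAt (fun y => v y - M) y := fun y hy =>
    (cont y (hne y hy)).sub continuousAt_const
  have := max_principle hUo (f := fun y => v y - M)
    (fun y hy => (hc y (le_of_lt hy.2)).continuousWithinAt)
    (fun y hy => ⟨0, le_rfl, by
      simpa using (lap y hy.1 (hne y (le_of_lt hy.2))).sub (hasLap_const M y)⟩) ?_ ?_ x ⟨hxo, hx⟩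
  · linarith
  · intro y hy η hη
    have hy1 : κ ≤ ‖y - axisPt t‖ := hcl (frontier_subset_closure hy)
    refine nhdsWithin_le_nhds ((hc y hy1).eventually (gt_mem_nhds (lt_of_le_of_lt ?_ hη)))
    by_cases hyo : y ∈ exterior ε
    · have h3 : ‖y - axisPt t‖ = κ := by
        refine le_antisymm ?_ hy1
        by_contra! h
        have := hy.2
        rw [hUo.interior_eq] at this
        exact this ⟨hyo, h⟩
      linarith [hM y h3]
    · simp only [zero y hyo]; linarith
  · intro η hη
    obtain ⟨ρ, hρ⟩ := decay η hη
    refine ⟨ρ, fun y _ h => ?_⟩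
    have := (abs_lt.1 (hρ y h)).2
    linarith

namespace IsZeroExt

variable {ε t : ℝ} {k : Fin 3} {R : E3 → ℝ}

lemma abs_le_outer (hR : IsZeroExt ε t k R) (hk : k ≠ 2) {κ : ℝ} (hε : 0 < ε) (hκ : 0 < κ)
    (hεκ : ε ≤ κ ^ 2) (htκ : |t| ≤ κ) (hκ1 : κ ≤ 1 / 20) {x : E3} (hx : κ ≤ ‖x - axisPt t‖) :
    |R x| ≤ 32 / κ ^ 2 * Real.exp (-(1 / (32 * κ))) := by
  have hM : ∀ y, ‖y - axisPt t‖ = κ → |R y| ≤ 32 / κ ^ 2 * Real.exp (-(1 / (32 * κ))) := by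
    intro y hy
    have hyp : y ≠ axisPt t := by
      intro h
      rw [h, sub_self, norm_zero] at hy
      linarith
    have := hR.abs_le_neck hk hε hκ hεκ htκ hκ1 hyp hy.le
    have h1 : κ / (32 * κ ^ 2) = 1 / (32 * κ) := by field_simp
    rwa [hy, h1] at this
  rw [abs_le']
  constructor
  · exact le_of_le_on_sphere hκ (by positivity) hR.lap hR.cont hR.zero hR.decay
      (fun y hy => (abs_le'.1 (hM y hy)).1) hx
  · exact le_of_le_on_sphere (v := fun y => -R y) hκ (by positivity)
      (fun y hy h => (hR.lap y hy h).neg) (fun y h => (hR.cont y h).neg)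
      (fun y hy => by rw [hR.zero y hy, neg_zero]) (by simpa only [abs_neg] using hR.decay)
      (fun y hy => (abs_le'.1 (hM y hy)).2) hx

lemma le_linear_on_sphere (hR : IsZeroExt ε t k R) (hk : k ≠ 2) (hε : 0 < ε) (hε1 : ε ≤ 1)
    (ht : |t| ≤ 1 / 2) {M : ℝ} (hM : ∀ y, 3 ≤ ‖y - axisPt t‖ → |R y| ≤ M) {y : E3}
    (hy : ‖y - axisPt t‖ = 4) (hyk : 0 < y k) : R y ≤ 6 * M * y k := by
  have hM0 : 0 ≤ M := (abs_nonneg _).trans (hM y (by linarith))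
  rcases le_or_gt (1 / 2) (y k) with h | h
  · have := (le_abs_self _).trans (hM y (by linarith))
    nlinarith
  set z := y - (y k) • edir k with hz
  have hzk : z k = 0 := by simp [hz, edir_apply]
  have hyz : ‖y - z‖ = y k := by
    rw [hz, sub_sub_cancel, norm_smul, Real.norm_of_nonneg hyk.le, edir]
    simp
  have hfar : ∀ w, ‖w - z‖ ≤ 1 / 2 → 3 < ‖w - axisPt t‖ := by
    intro w hw
    have h1 := norm_sub_le_norm_sub_add_norm_sub y z (axisPt t)
    have h2 := norm_sub_le_norm_sub_add_norm_sub z w (axisPt t)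
    rw [norm_sub_rev z w] at h2
    linarith
  have hne : ∀ w, ‖w - z‖ ≤ 1 / 2 → w ≠ axisPt t := by
    intro w hw h
    have := hfar w hw
    rw [h, sub_self, norm_zero] at this
    linarith
  have h1 := sub_mirror_le (u := R) (z := z) (s := 1 / 2) (M := M) (by norm_num)
    (fun w hw => hR.cont w (hne w hw))
    (fun w hw => hR.lap w (mem_exterior_of_far hε hε1 ht (hfar w hw)) (hne w hw))
    (fun w hw => hM w (hfar w hw).le) k (y := y) (by rw [hyz]; exact h) (by rwa [hzk])
    (by rw [hyz, hzk, sub_zero])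
  rw [hzk, hR.odd hk (hne y (by rw [hyz]; exact h.le))] at h1
  linarith

lemma abs_le_far (hR : IsZeroExt ε t k R) (hk : k ≠ 2) (hε : 0 < ε) (hε1 : ε ≤ 1)
    (ht : |t| ≤ 1 / 2) {M : ℝ} (hM : ∀ y, 3 ≤ ‖y - axisPt t‖ → |R y| ≤ M) {x : E3}
    (hx : 4 ≤ ‖x - axisPt t‖) : |R x| ≤ 6144 * M / ‖x - axisPt t‖ ^ 2 := by
  have hM0 : 0 ≤ M := (abs_nonneg _).trans (hM x (by linarith))
  have hne : ∀ y, 4 ≤ ‖y - axisPt t‖ → y ≠ axisPt t := by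
    intro y hy h
    rw [h, sub_self, norm_zero] at hy
    linarith
  set K := 1536 * π * M with hK
  have hK0 : 0 ≤ K := by positivity
  have hsph : ∀ y, ‖y - axisPt t‖ = 4 → 0 < y k → R y ≤ K * dip (edir k) (axisPt t) y := by
    intro y hy hyk
    have h1 := hR.le_linear_on_sphere hk hε hε1 ht hM hy hyk
    have h2 : K * dip (edir k) (axisPt t) y = 6 * M * y k := by
      rw [dip_eq' hk, hy, hK]; field_simp; ring
    linarith
  have h1 : IsOpen {y : E3 | 4 < ‖y - axisPt t‖} := isOpen_lt (by fun_prop) (by fun_prop)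
  have h2 : IsClosed {y : E3 | 4 ≤ ‖y - axisPt t‖} := isClosed_le (by fun_prop) (by fun_prop)
  have h3 : IsOpen {y : E3 | 0 < y k} := isOpen_lt (by fun_prop) (by fun_prop)
  have h4 : IsClosed {y : E3 | 0 ≤ y k} := isClosed_le (by fun_prop) (by fun_prop)
  have hUo := h1.inter h3
  have hcl : closure ({y : E3 | 4 < ‖y - axisPt t‖} ∩ {y | 0 < y k}) ⊆
      {y : E3 | 4 ≤ ‖y - axisPt t‖} ∩ {y | 0 ≤ y k} :=
    closure_minimal (fun y hy => ⟨show 4 ≤ ‖y - axisPt t‖ from le_of_lt hy.1,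
      show 0 ≤ y k from le_of_lt hy.2⟩) (h2.inter h4)
  have hc : ∀ y, 4 ≤ ‖y - axisPt t‖ →
      ContinuousAt (fun y => R y - K * dip (edir k) (axisPt t) y) y := fun y hy =>
    (hR.cont y (hne y hy)).sub (continuousAt_const.mul (continuousAt_dip hk (hne y hy)))
  have key := max_principle hUo (f := fun y => R y - K * dip (edir k) (axisPt t) y)
    (fun y hy => (hc y (le_of_lt hy.1)).continuousWithinAt)
    (fun y hy => by
      have h5 : 4 < ‖y - axisPt t‖ := hy.1
      refine ⟨0, le_rfl, ?_⟩
      simpa using (hR.lap y (mem_exterior_of_far hε hε1 ht (by linarith)) (hne y h5.le)).sub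
        ((hasLap_dip k (hne y h5.le)).const_mul K)) ?_ ?_
  · refine hR.abs_le_of_pos hk (hne x hx) (by positivity) fun y hy hyk => ?_
    have h5 : R y ≤ K * dip (edir k) (axisPt t) y := by
      rw [← hy] at hx
      rcases hx.eq_or_lt with h | h
      · exact hsph y h.symm hyk
      · have := key y ⟨h, hyk⟩
        linarith
    calc R y ≤ K * (1 / ‖y - axisPt t‖ ^ 2) :=
          h5.trans (mul_le_mul_of_nonneg_left (dip_le k t y) hK0)
      _ ≤ 1536 * 4 * M * (1 / ‖y - axisPt t‖ ^ 2) := by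
          rw [hK]; gcongr; exact pi_le_four
      _ = _ := by rw [hy]; ring
  · intro y hy η hη
    obtain ⟨hy1, hy2⟩ := hcl (frontier_subset_closure hy)
    refine nhdsWithin_le_nhds ((hc y hy1).eventually (gt_mem_nhds (lt_of_le_of_lt ?_ hη)))
    have h5 := hy.2
    rw [hUo.interior_eq] at h5
    rcases (show 0 ≤ y k from hy2).eq_or_lt with h | h
    · simp [hR.eq_zero_of_coord_eq_zero hk (hne y hy1) h.symm, dip_eq' hk, ← h]
    · have h6 : ‖y - axisPt t‖ = 4 := by
        refine le_antisymm ?_ hy1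
        by_contra! h7
        exact h5 ⟨h7, h⟩
      linarith [hsph y h6 h]
  · intro η hη
    obtain ⟨ρ, hρ⟩ := hR.decay η hη
    refine ⟨ρ, fun y hy h => ?_⟩
    have h5 := (abs_lt.1 (hρ y h)).2
    have h6 := mul_nonneg hK0 (dip_nonneg hk t (le_of_lt hy.2))
    linarith

end IsZeroExt

/-- The decay rate at distance `d` from the emitter. -/
def rate (ε t d : ℝ) : ℝ := d / ((√ε + |t|) * d + ε + |t| ^ 2)

lemma rate_denom_pos {ε d : ℝ} (hε : 0 < ε) (hd : 0 < d) (t : ℝ) :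
    0 < (√ε + |t|) * d + ε + |t| ^ 2 := by
  have := abs_nonneg t
  positivity

lemma rate_le_inv {ε d : ℝ} (hε : 0 < ε) (hd : 0 < d) (t : ℝ) :
    rate ε t d ≤ 1 / (√ε + |t|) := by
  have h1 : 0 < √ε := Real.sqrt_pos.2 hε
  have h2 := abs_nonneg t
  rw [rate, div_le_div_iff₀ (rate_denom_pos hε hd t) (by positivity)]
  nlinarith [sq_nonneg |t|]

lemma rate_le_div_sq {ε d : ℝ} (hε : 0 < ε) (hd : 0 < d) (t : ℝ) :
    rate ε t d ≤ 2 * d / (√ε + |t|) ^ 2 := by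
  have h1 : 0 < √ε := Real.sqrt_pos.2 hε
  have h2 := abs_nonneg t
  have h3 : √ε ^ 2 = ε := Real.sq_sqrt hε.le
  rw [rate, div_le_div_iff₀ (rate_denom_pos hε hd t) (by positivity)]
  have h4 : (√ε + |t|) ^ 2 ≤ 2 * ((√ε + |t|) * d + ε + |t| ^ 2) := by
    have : 0 ≤ (√ε + |t|) * d := by positivity
    nlinarith [sq_nonneg (√ε - |t|)]
  nlinarith

lemma half_rate_le {ε d d' : ℝ} (hε : 0 < ε) (hd : 0 < d) (h : d / 2 ≤ d') (t : ℝ) :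
    rate ε t d / 2 ≤ rate ε t d' := by
  have hd' : 0 < d' := by linarith
  have h1 := Real.sqrt_nonneg ε
  have h2 := abs_nonneg t
  rw [rate, rate, div_div,
    div_le_div_iff₀ (mul_pos (rate_denom_pos hε hd t) two_pos) (rate_denom_pos hε hd' t)]
  have h3 : 0 ≤ (√ε + |t|) * (d * d') := by positivity
  have h4 : 0 ≤ (ε + |t| ^ 2) * (2 * d' - d) := by
    have : 0 ≤ 2 * d' - d := by linarith
    positivity
  linarith

lemma inv_sq_mul_exp_le {κ : ℝ} (hκ : 0 < κ) :
    32 / κ ^ 2 * Real.exp (-(1 / (32 * κ))) ≤ 262144 * Real.exp (-(1 / (64 * κ))) := by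
  have h1 := Real.quadratic_le_exp_of_nonneg (x := 1 / (64 * κ)) (by positivity)
  have h2 : 0 < 1 / (64 * κ) := by positivity
  have h3 : 1 / κ ^ 2 = 4096 * (1 / (64 * κ)) ^ 2 := by field_simp; norm_num
  have h4 : -(1 / (32 * κ)) = -(1 / (64 * κ)) + -(1 / (64 * κ)) := by field_simp; norm_num
  rw [h4, Real.exp_add, ← mul_assoc]
  refine mul_le_mul_of_nonneg_right ?_ (Real.exp_pos _).le
  rw [Real.exp_neg, ← div_eq_mul_inv, div_le_iff₀ (Real.exp_pos _)]
  have h5 : 32 / κ ^ 2 = 32 * (1 / κ ^ 2) := by ring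
  rw [h5, h3]
  linarith

namespace IsZeroExt

variable {ε t : ℝ} {k : Fin 3} {R : E3 → ℝ}

lemma abs_le_exp (hR : IsZeroExt ε t k R) (hk : k ≠ 2) (hε : 0 < ε) (hε1 : ε ≤ 1)
    (ht : |t| ≤ 1 / 2) {x : E3} (hxp : x ≠ axisPt t) :
    |R x| ≤ 1610612736 / ‖x - axisPt t‖ ^ 2 * Real.exp (-(rate ε t ‖x - axisPt t‖ / 64)) := by
  have hd0 : 0 < ‖x - axisPt t‖ := norm_pos_iff.2 (sub_ne_zero.2 hxp)
  have hsq := hR.abs_le_inv_sq hk hxp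
  have hr1 := rate_le_inv hε hd0 t
  have hr2 := rate_le_div_sq hε hd0 t
  set κ := √ε + |t| with hκd
  have hε0 : 0 < √ε := Real.sqrt_pos.2 hε
  have ht0 := abs_nonneg t
  have hκ : 0 < κ := by positivity
  have hεκ : ε ≤ κ ^ 2 := by
    have : √ε ^ 2 = ε := Real.sq_sqrt hε.le
    rw [← this]
    gcongr
    linarith
  have htκ : |t| ≤ κ := by linarith
  set d := ‖x - axisPt t‖ with hd
  rcases lt_or_ge (1 / 20) κ with hκ1 | hκ1
  · have h1 : 1 / κ ≤ 20 := by
      rw [div_le_iff₀ hκ]; linarith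
    have h2 : Real.exp (-1) ≤ Real.exp (-(rate ε t d / 64)) := Real.exp_le_exp.2 (by linarith)
    have h3 := one_div_le_exp_neg_one.trans h2
    calc |R x| ≤ 1 / d ^ 2 * 1 := by rwa [mul_one]
      _ ≤ 1 / d ^ 2 * (1610612736 * Real.exp (-(rate ε t d / 64))) := by gcongr; linarith
      _ = _ := by ring
  have hexp : Real.exp (-(1 / (64 * κ))) ≤ Real.exp (-(rate ε t d / 64)) := by
    apply Real.exp_le_exp.2
    have : 1 / (64 * κ) = 1 / κ / 64 := by field_simp
    linarith
  have hE := (Real.exp_pos (-(rate ε t d / 64))).le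
  rcases le_total d κ with hdκ | hdκ
  · refine (hR.abs_le_neck hk hε hκ hεκ htκ hκ1 hxp hdκ).trans ?_
    have h1 : d / (32 * κ ^ 2) = 2 * d / κ ^ 2 / 64 := by field_simp; norm_num
    have h2 : Real.exp (-(d / (32 * κ ^ 2))) ≤ Real.exp (-(rate ε t d / 64)) :=
      Real.exp_le_exp.2 (by linarith)
    gcongr ?_ / _ * ?_
    norm_num
  have hout : ∀ y, κ ≤ ‖y - axisPt t‖ → |R y| ≤ 262144 * Real.exp (-(rate ε t d / 64)) :=
    fun y hy => (hR.abs_le_outer hk hε hκ hεκ htκ hκ1 hy).trans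
      ((inv_sq_mul_exp_le hκ).trans (by gcongr))
  rcases le_total d 4 with hd4 | hd4
  · refine (hout x hdκ).trans ?_
    gcongr
    rw [le_div_iff₀ (by positivity)]
    nlinarith
  · refine (hR.abs_le_far hk hε hε1 ht (fun y hy => hout y (by linarith)) hd4).trans ?_
    apply le_of_eq
    ring

lemma norm_gradient_le_exp (hR : IsZeroExt ε t k R) (hk : k ≠ 2) (hε : 0 < ε) (hε1 : ε ≤ 1)
    (ht : |t| ≤ 1 / 2) {x : E3} (hx : x ∈ exterior ε) (hxp : x ≠ axisPt t) :
    ‖gradient R x‖ ≤ 13915694039040 / ‖x - axisPt t‖ ^ 3 *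
      Real.exp (-(rate ε t ‖x - axisPt t‖ / 128)) := by
  have hd0 : 0 < ‖x - axisPt t‖ := norm_pos_iff.2 (sub_ne_zero.2 hxp)
  refine (hR.norm_gradient_le_of_abs_le hε hε1 ht hx hxp
    (M := 1610612736 / (‖x - axisPt t‖ / 2) ^ 2 * Real.exp (-(rate ε t ‖x - axisPt t‖ / 128)))
    fun y hy => ?_).trans (le_of_eq ?_)
  · have hyp : y ≠ axisPt t := by
      intro h
      rw [h, sub_self, norm_zero] at hy
      linarith
    refine (hR.abs_le_exp hk hε hε1 ht hyp).trans ?_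
    have h1 := half_rate_le hε hd0 hy t
    have h2 : Real.exp (-(rate ε t ‖y - axisPt t‖ / 64)) ≤
        Real.exp (-(rate ε t ‖x - axisPt t‖ / 128)) := Real.exp_le_exp.2 (by linarith)
    gcongr
  · field_simp
    norm_num

end IsZeroExt

lemma isZeroExt_indicator {ε t : ℝ} (hε : 0 < ε) {k : Fin 3} {r : E3 → ℝ}
    (harm : IsHarmonicOn r (closure (D1 ε ∪ D2 ε) ∪ {axisPt t})ᶜ)
    (emit : ∃ V : Set E3, IsOpen V ∧ axisPt t ∈ V ∧ ∃ h : E3 → ℝ, IsHarmonicOn h V ∧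
      ∀ x ∈ V \ {axisPt t}, r x = dip (edir k) (axisPt t) x + h x)
    (bdry : ∀ x ∈ Metric.sphere (ctr1 ε) 1 ∪ Metric.sphere (ctr2 ε) 1,
      Tendsto r (𝓝[(closure (D1 ε ∪ D2 ε))ᶜ] x) (𝓝 0))
    (decay : ∃ C R : ℝ, ∀ x : E3, R ≤ ‖x‖ → |r x| ≤ C / ‖x‖ ^ 2) :
    IsZeroExt ε t k ((exterior ε).indicator r) := by
  have hev : ∀ x ∈ exterior ε, (exterior ε).indicator r =ᶠ[𝓝 x] r := fun x hx => by
    filter_upwards [(isOpen_exterior ε).mem_nhds hx] with y hy using Set.indicator_of_mem hy r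
  have hset : (closure (D1 ε ∪ D2 ε) ∪ {axisPt t})ᶜ = exterior ε ∩ {axisPt t}ᶜ := by
    rw [Set.compl_union, compl_closure_eq_exterior]
  rw [hset] at harm
  rw [compl_closure_eq_exterior] at bdry
  have hso : IsOpen (exterior ε ∩ {axisPt t}ᶜ) :=
    (isOpen_exterior ε).inter isOpen_compl_singleton
  refine ⟨?_, ?_, fun x hx => Set.indicator_of_notMem hx r, ?_, ?_⟩
  · intro x hx hxp
    exact (harm.hasLap hso ⟨hx, hxp⟩).congr (hev x hx)
  · intro x hxp
    by_cases hx : x ∈ exterior ε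
    · exact (((harm.1.continuousOn.continuousAt (hso.mem_nhds ⟨hx, hxp⟩))).congr (hev x hx).symm)
    · rw [ContinuousAt, Set.indicator_of_notMem hx, ← nhdsWithin_univ,
        ← Set.union_compl_self (exterior ε), nhdsWithin_union]
      refine Tendsto.sup ?_ ?_
      · by_cases hcl : x ∈ closure (exterior ε)
        · have h1 := closure_exterior_subset ε hcl
          refine (bdry x ?_).congr' ?_
          · by_contra! hs
            rw [Set.mem_union, mem_sphere, mem_sphere, dist_eq_norm, dist_eq_norm, not_or] at hs
            exact hx ⟨lt_of_le_of_ne h1.1 (Ne.symm hs.1), lt_of_le_of_ne h1.2 (Ne.symm hs.2)⟩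
          · filter_upwards [self_mem_nhdsWithin] with y hy
              using (Set.indicator_of_mem hy r).symm
        · rw [mem_closure_iff_nhdsWithin_neBot, not_neBot] at hcl
          rw [hcl]
          exact tendsto_bot
      · refine tendsto_const_nhds.congr' ?_
        filter_upwards [self_mem_nhdsWithin] with y hy
          using (Set.indicator_of_notMem hy r).symm
  · obtain ⟨V, hV, hpV, h, hh, hr⟩ := emit
    refine ⟨h, hh.1.continuousOn.continuousAt (hV.mem_nhds hpV), ?_⟩
    have hp : axisPt t ∈ exterior ε := by
      rw [mem_exterior_iff]
      simp [axisPt_apply]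
      constructor <;> nlinarith [sq_nonneg t]
    filter_upwards [nhdsWithin_le_nhds (hV.mem_nhds hpV),
      nhdsWithin_le_nhds ((isOpen_exterior ε).mem_nhds hp), self_mem_nhdsWithin] with x h1 h2 h3
    rw [Set.indicator_of_mem h2]
    exact hr x ⟨h1, h3⟩
  · intro η hη
    obtain ⟨C, ρ, hC⟩ := decay
    refine ⟨max ρ (|C| / η + 1), fun x hx => ?_⟩
    by_cases hxo : x ∈ exterior ε
    swap
    · rwa [Set.indicator_of_notMem hxo, abs_zero]
    rw [Set.indicator_of_mem hxo]
    have h1 := (le_max_right _ _).trans hx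
    have h0 : 0 ≤ |C| / η := by positivity
    have h2 : 1 ≤ ‖x‖ := by linarith
    refine (hC x ((le_max_left _ _).trans hx)).trans_lt ?_
    rw [div_lt_iff₀ (by positivity)]
    have h3 : |C| < η * ‖x‖ := by
      have : |C| / η < ‖x‖ := by linarith
      rwa [div_lt_iff₀' hη] at this
    have h4 := le_abs_self C
    have : η * ‖x‖ ≤ η * ‖x‖ ^ 2 := by
      gcongr
      exact le_self_pow₀ h2 two_ne_zero
    linarith

/-- Proposition 5.1: gradient estimate for the non-enhanced part `r` when
`a = (1,0,0)` or `a = (0,1,0)`. -/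
theorem stmt11 :
    ∃ A ε₀ c : ℝ, 0 < A ∧ 0 < ε₀ ∧ 0 < c ∧
    ∀ a : E3, (a = e0 ∨ a = e1) →
    ∀ ε p₃ : ℝ, 0 < ε → ε ≤ ε₀ → |p₃| ≤ 1 / 2 →
    ∀ r : E3 → ℝ,
      IsHarmonicOn r (closure (D1 ε ∪ D2 ε) ∪ {p₃ • e2})ᶜ →
      (∃ V : Set E3, IsOpen V ∧ p₃ • e2 ∈ V ∧ ∃ h : E3 → ℝ, IsHarmonicOn h V ∧
        ∀ x ∈ V \ {p₃ • e2}, r x = dip a (p₃ • e2) x + h x) →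
      (∀ x ∈ Metric.sphere (ctr1 ε) 1 ∪ Metric.sphere (ctr2 ε) 1,
        Filter.Tendsto r (nhdsWithin x (closure (D1 ε ∪ D2 ε))ᶜ) (nhds 0)) →
      (∃ C R : ℝ, ∀ x : E3, R ≤ ‖x‖ → |r x| ≤ C / ‖x‖ ^ 2) →
      ∀ x : E3, x ∉ closure (D1 ε ∪ D2 ε) → x ≠ p₃ • e2 →
        ‖gradient r x‖ ≤ c / ‖x - p₃ • e2‖ ^ 3 *
          Real.exp (-(A * ‖x - p₃ • e2‖ /
            ((Real.sqrt ε + |p₃|) * ‖x - p₃ • e2‖ + ε + |p₃| ^ 2))) := by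
  refine ⟨1 / 128, 1, 13915694039040, by norm_num, by norm_num, by norm_num, ?_⟩
  intro a ha ε t hε hε1 ht r harm emit bdry decay x hx hxp
  obtain ⟨k, hk, rfl⟩ : ∃ k : Fin 3, k ≠ 2 ∧ a = edir k := by
    rcases ha with rfl | rfl
    · exact ⟨0, by decide, rfl⟩
    · exact ⟨1, by decide, rfl⟩
  have hxo : x ∈ exterior ε := by rwa [← compl_closure_eq_exterior]
  have hR := isZeroExt_indicator hε harm emit bdry decay
  have hgrad : gradient ((exterior ε).indicator r) x = gradient r x := by
    have : (exterior ε).indicator r =ᶠ[𝓝 x] r := by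
      filter_upwards [(isOpen_exterior ε).mem_nhds hxo] with y hy using Set.indicator_of_mem hy r
    rw [gradient, gradient, this.fderiv_eq]
  have h := hR.norm_gradient_le_exp hk hε hε1 ht hxo hxp
  rw [hgrad] at h
  refine h.trans (le_of_eq ?_)
  have h2 : ∀ b c : ℝ, 1 / 128 * b / c = b / c / 128 := fun b c => by ring
  rw [h2]
  rfl
end
end

section
/- Let ε > 0 and p = (0,0,p₃) with |p₃| ≤ 1/2. Set ε_* = (ε + p₃² + ε²/4)⁻¹, p_* = (1−ε_*)p, and Φ(y) = (y−p)/|y−p|² + p for y ≠ p. Define Ψ(z) = Φ(ε_* z + p_*) for z ≠ p. Then: (a) Ψ(z) = ε_*⁻¹ (z−p)/|z−p|² + p for all z ≠ p, i.e., Ψ is the inversion about the sphere centered at p of radius squared ε + p₃² + ε²/4; (b) Ψ is an involution of ℝ³ ∖ {p}, i.e., Ψ(Ψ(z)) = z; (c) Ψ maps the sphere ∂D_j onto ∂D_j for j = 1,2; and (d) Ψ maps ℝ³ ∖ (closure of D₁ ∪ D₂ ∪ {p}) onto itself. -/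
open MeasureTheory Metric Real Filter
open scoped RealInnerProductSpace

noncomputable section

/-- The inversion of `ℝ³ \ {p}` about the unit sphere centered at `p`. -/
def Φ (p y : E3) : E3 := (‖y - p‖ ^ 2)⁻¹ • (y - p) + p

section Inversion

open EuclideanGeometry

variable {V : Type*} [NormedAddCommGroup V] [InnerProductSpace ℝ V] {p c z : V} {R r : ℝ}

/-- If `p` has power `R ^ 2` with respect to the sphere of center `c` and radius `r`, then inversion
about `sphere p R` rescales the power of points with respect to that sphere. -/
theorem dist_inversion_sq_sub_of_power (hc : dist c p ^ 2 = R ^ 2 + r ^ 2) (hz : z ≠ p) :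
    dist (inversion p R z) c ^ 2 - r ^ 2 = (R / dist z p) ^ 2 * (dist z c ^ 2 - r ^ 2) := by
  have hw : ‖z - p‖ ≠ 0 := norm_ne_zero_iff.2 (sub_ne_zero.2 hz)
  have h₁ : inversion p R z - c = (R / ‖z - p‖) ^ 2 • (z - p) - (c - p) := by
    simp only [inversion, vsub_eq_sub, vadd_eq_add, dist_eq_norm]
    abel
  have h₂ : z - c = (z - p) - (c - p) := by abel
  rw [dist_eq_norm] at hc
  rw [dist_eq_norm, dist_eq_norm, dist_eq_norm, h₁, h₂, norm_sub_sq_real _ (c - p),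
    norm_sub_sq_real _ (c - p), norm_smul, inner_smul_left, hc, Real.norm_of_nonneg (sq_nonneg _)]
  simp only [conj_trivial]
  field_simp
  ring

theorem inversion_mem_sphere_iff_of_power (hR : 0 < R) (hr : 0 ≤ r)
    (hc : dist c p ^ 2 = R ^ 2 + r ^ 2) :
    inversion p R z ∈ sphere c r ↔ z ∈ sphere c r := by
  rcases eq_or_ne z p with rfl | hz
  · rw [inversion_self]
  have h := dist_inversion_sq_sub_of_power hc hz
  have hk : (R / dist z p) ^ 2 ≠ 0 := pow_ne_zero _ (div_ne_zero hR.ne' (dist_ne_zero.2 hz))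
  rw [Metric.mem_sphere, Metric.mem_sphere, ← sq_eq_sq₀ dist_nonneg hr, ← sq_eq_sq₀ dist_nonneg hr,
    ← sub_eq_zero, h, mul_eq_zero, or_iff_right hk, sub_eq_zero]

theorem inversion_mem_closedBall_iff_of_power (hR : 0 < R) (hr : 0 ≤ r)
    (hc : dist c p ^ 2 = R ^ 2 + r ^ 2) :
    inversion p R z ∈ closedBall c r ↔ z ∈ closedBall c r := by
  rcases eq_or_ne z p with rfl | hz
  · rw [inversion_self]
  have h := dist_inversion_sq_sub_of_power hc hz
  have hk : 0 < (R / dist z p) ^ 2 := pow_pos (div_pos hR (dist_pos.2 hz)) _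
  rw [mem_closedBall, mem_closedBall, ← sq_le_sq₀ dist_nonneg hr, ← sq_le_sq₀ dist_nonneg hr,
    ← sub_nonpos, h, ← sub_nonpos (a := dist z c ^ 2), ← neg_nonneg, ← mul_neg,
    mul_nonneg_iff_of_pos_left hk, neg_nonneg]

end Inversion

theorem dist_smul_e0_smul_e2_sq (a b : ℝ) : dist (a • e0) (b • e2) ^ 2 = a ^ 2 + b ^ 2 := by
  rw [EuclideanSpace.dist_eq, Real.sq_sqrt (Finset.sum_nonneg fun _ _ => sq_nonneg _)]
  simp [Fin.sum_univ_three, e0, e2, Real.dist_eq, sq_abs]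

/-- Properties of the map `Ψ(z) = Φ(ε_* z + p_*)`: it is the inversion about the sphere
centered at `p` of radius squared `ε + p₃² + ε²/4`, an involution of `ℝ³ \ {p}`, and it
maps each sphere `∂D_j` onto itself and the exterior region onto itself. -/
theorem stmt19 (ε p₃ : ℝ) (hε : 0 < ε) (hp : |p₃| ≤ 1 / 2) :
    ∀ εs ps Ψ, εs = (ε + p₃ ^ 2 + ε ^ 2 / 4)⁻¹ → ps = (1 - εs) • (p₃ • e2 : E3) →
    Ψ = (fun z : E3 => Φ (p₃ • e2) (εs • z + ps)) →
    (∀ z : E3, z ≠ p₃ • e2 → Ψ z = (εs⁻¹ / ‖z - p₃ • e2‖ ^ 2) • (z - p₃ • e2) + p₃ • e2) ∧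
    (∀ z : E3, z ≠ p₃ • e2 → Ψ (Ψ z) = z) ∧
    Ψ '' Metric.sphere (ctr1 ε) 1 = Metric.sphere (ctr1 ε) 1 ∧
    Ψ '' Metric.sphere (ctr2 ε) 1 = Metric.sphere (ctr2 ε) 1 ∧
    Ψ '' (closure (D1 ε ∪ D2 ε) ∪ {(p₃ • e2 : E3)})ᶜ = (closure (D1 ε ∪ D2 ε) ∪ {(p₃ • e2 : E3)})ᶜ := by
  rintro εs ps Ψ hεs rfl hΨ
  have hpow : 0 < ε + p₃ ^ 2 + ε ^ 2 / 4 := by positivity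
  set p : E3 := p₃ • e2 with hpdef
  set R : ℝ := √(ε + p₃ ^ 2 + ε ^ 2 / 4)
  have hR : 0 < R := Real.sqrt_pos.2 hpow
  have hR2 : R ^ 2 = ε + p₃ ^ 2 + ε ^ 2 / 4 := Real.sq_sqrt hpow.le
  have hεR : εs = (R ^ 2)⁻¹ := by rw [hεs, hR2]
  have hεs0 : 0 < εs := hεR ▸ by positivity
  have hinv : Ψ = EuclideanGeometry.inversion p R := by
    funext z
    have hsub : εs • z + (1 - εs) • p - p = εs • (z - p) := by module
    simp only [hΨ, Φ, hsub, EuclideanGeometry.inversion, vsub_eq_sub, vadd_eq_add, dist_eq_norm,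
      norm_smul, Real.norm_of_nonneg hεs0.le, smul_smul]
    congr 2
    rw [hεR]
    field_simp
  have hinvol : Function.Involutive Ψ := hinv ▸ EuclideanGeometry.inversion_involutive p hR.ne'
  have hc₁ : dist (ctr1 ε) p ^ 2 = R ^ 2 + 1 ^ 2 := by
    rw [ctr1, hpdef, dist_smul_e0_smul_e2_sq, hR2]
    ring
  have hc₂ : dist (ctr2 ε) p ^ 2 = R ^ 2 + 1 ^ 2 := by
    rw [ctr2, hpdef, dist_smul_e0_smul_e2_sq, hR2]
    ring
  have himage (s : Set E3) (hs : ∀ z, Ψ z ∈ s ↔ z ∈ s) : Ψ '' s = s := by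
    rw [Set.image_eq_preimage_of_inverse hinvol.leftInverse hinvol.rightInverse]
    exact Set.ext hs
  refine ⟨fun z _ => ?_, fun z _ => hinvol z, himage _ fun z => ?_, himage _ fun z => ?_,
    himage _ fun z => ?_⟩
  · rw [hinv, EuclideanGeometry.inversion, hεR, inv_inv, div_pow, dist_eq_norm, vsub_eq_sub,
      vadd_eq_add]
  · rw [hinv]
    exact inversion_mem_sphere_iff_of_power hR zero_le_one hc₁
  · rw [hinv]
    exact inversion_mem_sphere_iff_of_power hR zero_le_one hc₂
  · have hp_iff : Ψ z = p ↔ z = p := by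
      rw [← hinvol.injective.eq_iff (a := z), hinv, EuclideanGeometry.inversion_self]
    rw [closure_union, D1, D2, closure_ball _ one_ne_zero, closure_ball _ one_ne_zero]
    simp only [Set.mem_compl_iff, Set.mem_union, Set.mem_singleton_iff, hp_iff]
    rw [hinv, inversion_mem_closedBall_iff_of_power hR zero_le_one hc₁,
      inversion_mem_closedBall_iff_of_power hR zero_le_one hc₂]
end
end
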